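/- arXiv:1108.3746 — 9 statements merged into one kernel-verified Lean document; each statement's English description precedes it below -/
import Mathlib

section
/- Let (X, μ) be a probability space and f : X → X a measurable, μ-preserving, ergodic map. Let S : X → 𝒮ⁿ be any map, and write S^k_x := S_{f^{k−1}(x)}⋯S_x and Ŝ^k_x := (Q S_{f^{k−1}(x)} Q)⋯(Q S_x Q). Suppose (V_x)_{x∈X} is a family of linear subspaces of ℝⁿ satisfying S_x(V_x) ⊆ V_{f(x)} for every x ∈ X, and suppose there exist α ∈ (0, π/2] and a measurable set A ⊆ X with μ(A) > 0 such that ‖Qw‖ ≥ sin(α)·‖w‖ for every x ∈ A and every w ∈ V_x. Then for μ-almost every x ∈ X, every v ∈ V_x ∖ {0} and every λ ∈ [−∞, 0]: if lim_{k→∞} (1/k) log‖S^k_x v‖ = λ (with the convention log 0 = −∞), then limsup_{k→∞} (1/k) log‖Ŝ^k_x(Qv)‖ = λ. -/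
open Matrix Filter Topology

/-- `S` is a row-stochastic matrix: all entries in `[0,1]` and each row sums to `1`. -/
def IsStochastic {n : ℕ} (S : Matrix (Fin n) (Fin n) ℝ) : Prop :=
  (∀ i j, 0 ≤ S i j ∧ S i j ≤ 1) ∧ ∀ i, ∑ j, S i j = 1

/-- The unit vector `u = (1/√n, …, 1/√n)`. -/
noncomputable def uvec (n : ℕ) : Fin n → ℝ := fun _ => 1 / Real.sqrt n

/-- The orthogonal projection onto the line `ℝu`, i.e. `(1/n)·J` with `J` the all-ones matrix. -/
noncomputable def Pmat (n : ℕ) : Matrix (Fin n) (Fin n) ℝ := Matrix.of fun _ _ => (1 : ℝ) / n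

/-- The orthogonal projection `Q = I − P` onto the hyperplane `N = {v : ∑ᵢ vᵢ = 0}`. -/
noncomputable def Qmat (n : ℕ) : Matrix (Fin n) (Fin n) ℝ := 1 - Pmat n

/-- `ℝⁿ` with the Euclidean norm. -/
noncomputable def toE {n : ℕ} (v : Fin n → ℝ) : EuclideanSpace ℝ (Fin n) :=
  (EuclideanSpace.equiv (Fin n) ℝ).symm v

/-- The operator norm of a matrix induced by the Euclidean norm on `ℝⁿ`. -/
noncomputable def opNorm {n : ℕ} (S : Matrix (Fin n) (Fin n) ℝ) : ℝ :=
  ‖LinearMap.toContinuousLinearMap (Matrix.toEuclideanLin S)‖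

/-- The hyperplane `N = {v ∈ ℝⁿ : ∑ᵢ vᵢ = 0}`. -/
noncomputable def Nhyp (n : ℕ) : Submodule ℝ (Fin n → ℝ) :=
  LinearMap.ker (∑ i : Fin n, (LinearMap.proj i : (Fin n → ℝ) →ₗ[ℝ] ℝ))

/-- Logarithm with values in `EReal`, with the convention `log 0 = −∞`. -/
noncomputable def elog (r : ℝ) : EReal := if r ≤ 0 then ⊥ else ((Real.log r : ℝ) : EReal)

/-- The cocycle iterates `S^k_x = S_{f^{k−1}(x)} ⋯ S_{f(x)} S_x`. -/
noncomputable def cocycle {n : ℕ} {X : Type*} (f : X → X) (S : X → Matrix (Fin n) (Fin n) ℝ) :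
    ℕ → X → Matrix (Fin n) (Fin n) ℝ
  | 0, _ => 1
  | k + 1, x => S (f^[k] x) * cocycle f S k x

/-- The ordered product `prodA S k = S_{k−1} ⋯ S_1 S_0`. -/
noncomputable def prodA {n : ℕ} (S : ℕ → Matrix (Fin n) (Fin n) ℝ) :
    ℕ → Matrix (Fin n) (Fin n) ℝ
  | 0 => 1
  | k + 1 => S k * prodA S k

theorem Pmat_mulVec {n : ℕ} (v : Fin n → ℝ) :
    (Pmat n).mulVec v = fun _ => (∑ j, v j) / n := by
  ext i
  simp [Pmat, mulVec, dotProduct, ← Finset.mul_sum, div_eq_inv_mul]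

theorem Qmat_mulVec_apply {n : ℕ} (v : Fin n → ℝ) (i : Fin n) :
    (Qmat n).mulVec v i = v i - (∑ j, v j) / n := by
  rw [Qmat, sub_mulVec, one_mulVec, Pmat_mulVec, Pi.sub_apply]

theorem Qmat_mulVec_const {n : ℕ} (c : ℝ) : (Qmat n).mulVec (fun _ => c) = 0 := by
  ext i
  have hn : (n : ℝ) ≠ 0 := Nat.cast_ne_zero.mpr (Fin.pos i).ne'
  rw [Qmat_mulVec_apply]
  simp [hn]

theorem IsStochastic.mulVec_const {n : ℕ} {S : Matrix (Fin n) (Fin n) ℝ} (hS : IsStochastic S)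
    (c : ℝ) : S.mulVec (fun _ => c) = fun _ => c := by
  ext i
  simp [mulVec, dotProduct, ← Finset.sum_mul, hS.2 i]

theorem IsStochastic.Qmat_mul_mul_Qmat {n : ℕ} {S : Matrix (Fin n) (Fin n) ℝ}
    (hS : IsStochastic S) : Qmat n * S * Qmat n = Qmat n * S := by
  have h : Qmat n * S * Pmat n = 0 := by
    refine Matrix.mulVec_injective (funext fun v => ?_)
    rw [← mulVec_mulVec, ← mulVec_mulVec, Pmat_mulVec, hS.mulVec_const, Qmat_mulVec_const,
      zero_mulVec]
  conv_lhs => rw [Qmat, mul_sub, mul_one]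
  rw [← Qmat, h, sub_zero]

theorem cocycle_Qmat_mul_Qmat {n : ℕ} {X : Type*} (f : X → X)
    (S : X → Matrix (Fin n) (Fin n) ℝ) (hS : ∀ x, IsStochastic (S x)) (k : ℕ) (x : X) :
    cocycle f (fun y => Qmat n * S y * Qmat n) k x * Qmat n = Qmat n * cocycle f S k x := by
  induction k with
  | zero => simp [cocycle]
  | succ k ih =>
    rw [cocycle, mul_assoc, ih, cocycle, ← mul_assoc, ← mul_assoc]
    simp only [(hS _).Qmat_mul_mul_Qmat]

theorem cocycle_mulVec_mem {n : ℕ} {X : Type*} (f : X → X)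
    (S : X → Matrix (Fin n) (Fin n) ℝ) (V : X → Submodule ℝ (Fin n → ℝ))
    (hinv : ∀ x, ∀ v ∈ V x, (S x).mulVec v ∈ V (f x)) {x : X} {v : Fin n → ℝ} (hv : v ∈ V x)
    (k : ℕ) : (cocycle f S k x).mulVec v ∈ V (f^[k] x) := by
  induction k with
  | zero => simpa [cocycle] using hv
  | succ k ih =>
    rw [cocycle, ← mulVec_mulVec, Function.iterate_succ_apply']
    exact hinv _ _ ih

theorem norm_toE_Qmat_mulVec_le {n : ℕ} (w : Fin n → ℝ) :
    ‖toE ((Qmat n).mulVec w)‖ ≤ ‖toE w‖ := by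
  refine (sq_le_sq₀ (norm_nonneg _) (norm_nonneg _)).mp ?_
  rw [EuclideanSpace.norm_sq_eq, EuclideanSpace.norm_sq_eq]
  simp only [toE, PiLp.continuousLinearEquiv_symm_apply, Real.norm_eq_abs, sq_abs,
    Qmat_mulVec_apply]
  rcases Nat.eq_zero_or_pos n with rfl | hn
  · simp
  have hn' : (0 : ℝ) < n := Nat.cast_pos.mpr hn
  set m := (∑ j, w j) / (n : ℝ) with hm
  have hs : ∑ j, w j = n * m := by rw [hm]; field_simp
  have h : ∑ i, (w i - m) ^ 2 = ∑ i, w i ^ 2 - n * m ^ 2 := by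
    simp only [sub_sq, Finset.sum_add_distrib, Finset.sum_sub_distrib, ← Finset.sum_mul,
      ← Finset.mul_sum, hs, Finset.sum_const, Finset.card_univ, Fintype.card_fin, nsmul_eq_mul]
    ring
  rw [h]
  nlinarith [sq_nonneg m]

theorem elog_mono : Monotone elog := by
  intro a b hab
  unfold elog
  split_ifs with ha hb hb
  · exact le_rfl
  · exact bot_le
  · linarith
  · exact EReal.coe_le_coe_iff.mpr (Real.log_le_log (not_le.mp ha) hab)

theorem coe_add_mul_elog_le {c s r t : ℝ} (hc : 0 < c) (hs : 0 < s) (h : s * r ≤ t) :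
    ((c * Real.log s : ℝ) : EReal) + (c : EReal) * elog r ≤ (c : EReal) * elog t := by
  by_cases hr : r ≤ 0
  · simp [elog, hr, EReal.coe_mul_bot_of_pos hc]
  have hr' : 0 < r := not_le.mp hr
  have ht : 0 < t := (mul_pos hs hr').trans_le h
  rw [elog, elog, if_neg hr, if_neg ht.not_ge, ← EReal.coe_mul, ← EReal.coe_mul, ← EReal.coe_add,
    EReal.coe_le_coe_iff, ← mul_add, ← Real.log_mul hs.ne' hr'.ne']
  exact mul_le_mul_of_nonneg_left (Real.log_le_log (mul_pos hs hr') h) hc.le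

/-- If `s * r k ≤ t k` for infinitely many `k` and `t k ≤ r k` always, then the exponential growth
rate of `r` is the upper exponential growth rate of `t`. -/
theorem limsup_inv_mul_elog_eq {r t : ℕ → ℝ} {s : ℝ} {l : EReal} (hs : 0 < s)
    (hle : ∀ k, t k ≤ r k) (hfreq : ∃ᶠ k in atTop, s * r k ≤ t k)
    (hlim : Tendsto (fun k : ℕ => (((k : ℝ)⁻¹ : ℝ) : EReal) * elog (r k)) atTop (𝓝 l)) :
    limsup (fun k : ℕ => (((k : ℝ)⁻¹ : ℝ) : EReal) * elog (t k)) atTop = l := by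
  apply le_antisymm
  · rw [← hlim.limsup_eq]
    refine limsup_le_limsup (Eventually.of_forall fun k => ?_)
    exact mul_le_mul_of_nonneg_left (elog_mono (hle k)) (EReal.coe_nonneg.mpr (by positivity))
  · have h0 : Tendsto (fun k : ℕ => (((k : ℝ)⁻¹ * Real.log s : ℝ) : EReal)) atTop
        (𝓝 ((0 : ℝ) : EReal)) := by
      refine (continuous_coe_real_ereal.tendsto 0).comp ?_
      simpa using (tendsto_inv_atTop_nhds_zero_nat (𝕜 := ℝ)).mul_const (Real.log s)
    have hsum := (EReal.continuousAt_add (p := (((0 : ℝ) : EReal), l))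
      (Or.inl (EReal.coe_ne_top 0)) (Or.inl (EReal.coe_ne_bot 0))).tendsto.comp
      (h0.prodMk_nhds hlim)
    simp only [EReal.coe_zero, zero_add] at hsum
    refine le_of_forall_lt fun b hb => ?_
    obtain ⟨b', hbb', hb'⟩ := exists_between hb
    refine hbb'.trans_le (le_limsup_of_frequently_le' ?_)
    refine (hfreq.and_eventually ((hsum.eventually_const_lt hb').and
      (eventually_gt_atTop 0))).mono fun k ⟨hk, hk', hk0⟩ => ?_
    exact hk'.le.trans (coe_add_mul_elog_le (inv_pos.mpr (Nat.cast_pos.mpr hk0)) hs hk)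

/-- Almost every orbit of an ergodic map of a finite measure space visits a given set of positive
measure infinitely often. -/
theorem Ergodic.ae_frequently_iterate_mem {X : Type*} [MeasurableSpace X]
    {μ : MeasureTheory.Measure X} [MeasureTheory.IsFiniteMeasure μ] {f : X → X}
    (hf : Ergodic f μ) {A : Set X} (hA : MeasurableSet A) (hμA : μ A ≠ 0) :
    ∀ᵐ x ∂μ, ∃ᶠ k in atTop, f^[k] x ∈ A := by
  have hmeas : MeasurableSet {x | ∃ᶠ k in atTop, f^[k] x ∈ A} := by
    have h := MeasurableSet.measurableSet_limsup fun k => hf.measurable.iterate k hA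
    convert h using 1
    ext x
    simp [mem_limsup_iff_frequently_mem]
  have hinv : f ⁻¹' {x | ∃ᶠ k in atTop, f^[k] x ∈ A} = {x | ∃ᶠ k in atTop, f^[k] x ∈ A} := by
    ext x
    simp only [Set.mem_preimage, Set.mem_ofPred_eq, ← Function.iterate_succ_apply]
    conv_rhs => rw [← map_add_atTop_eq_nat 1, frequently_map]
  refine (hf.toPreErgodic.ae_mem_or_ae_notMem hmeas hinv).resolve_right fun hnot => ?_
  have hrec := hf.toMeasurePreserving.conservative.frequently_ae_mem_and_frequently_image_mem
    hA.nullMeasurableSet hμA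
  obtain ⟨x, hx, hx'⟩ := (hrec.and_eventually hnot).exists
  exact hx' hx.2

/-- Let `(X, μ)` be a probability space and `f` a measurable, μ-preserving,
ergodic map, `S : X → 𝒮ⁿ` arbitrary, and `(V_x)` an `S`-invariant family of subspaces such
that on a set `A` of positive measure the angle condition `‖Qw‖ ≥ sin α · ‖w‖` holds on `V_x`.
Then a.e., for every `v ∈ V_x ∖ {0}` and every `λ ∈ [−∞, 0]`: if
`lim (1/k) log‖S^k_x v‖ = λ` then `limsup (1/k) log‖Ŝ^k_x (Qv)‖ = λ`. -/
theorem stmt1 {n : ℕ} {X : Type*} [MeasurableSpace X] (μ : MeasureTheory.Measure X)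
    [MeasureTheory.IsProbabilityMeasure μ] (f : X → X) (hf : Ergodic f μ)
    (S : X → Matrix (Fin n) (Fin n) ℝ) (hS : ∀ x, IsStochastic (S x))
    (V : X → Submodule ℝ (Fin n → ℝ))
    (hinv : ∀ x, ∀ v ∈ V x, (S x).mulVec v ∈ V (f x))
    (α : ℝ) (hα : α ∈ Set.Ioc 0 (Real.pi / 2))
    (A : Set X) (hA : MeasurableSet A) (hApos : 0 < μ A)
    (hangle : ∀ x ∈ A, ∀ w ∈ V x, Real.sin α * ‖toE w‖ ≤ ‖toE ((Qmat n).mulVec w)‖) :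
    ∀ᵐ x ∂μ, ∀ v ∈ V x, v ≠ 0 → ∀ l : EReal, l ≤ 0 →
      Tendsto (fun k : ℕ => (((k : ℝ)⁻¹ : ℝ) : EReal) *
          elog ‖toE ((cocycle f S k x).mulVec v)‖) atTop (nhds l) →
      Filter.limsup (fun k : ℕ => (((k : ℝ)⁻¹ : ℝ) : EReal) *
          elog ‖toE ((cocycle f (fun y => Qmat n * S y * Qmat n) k x).mulVec
            ((Qmat n).mulVec v))‖) atTop = l := by
  filter_upwards [hf.ae_frequently_iterate_mem hA hApos.ne'] with x hx v hv _ l _ hlim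
  have hsin : 0 < Real.sin α :=
    Real.sin_pos_of_pos_of_lt_pi hα.1 (hα.2.trans_lt (half_lt_self Real.pi_pos))
  simp only [mulVec_mulVec, cocycle_Qmat_mul_Qmat f S hS]
  simp only [← mulVec_mulVec]
  exact limsup_inv_mul_elog_eq hsin (fun k => norm_toE_Qmat_mulVec_le _)
    (hx.mono fun k hk => hangle _ hk _ (cocycle_mulVec_mem f S V hinv hv k)) hlim
end

section
/- Let n ≥ 2, let M be a compact metric space, f : M → M a homeomorphism, and S : M → 𝒮ⁿ continuous with sup_{x∈M} ‖Q S_x Q‖ < 1 (operator norm); write S^k_x := S_{f^{k−1}(x)}⋯S_x. For x ∈ M define E^{<0}_x := {v ∈ ℝⁿ : limsup_{k→∞} (1/k) log‖S^k_x v‖ < 0} (with log 0 = −∞). Then for every x ∈ M: E^{<0}_x is a linear subspace of dimension n − 1; ℝⁿ = ℝu ⊕ E^{<0}_x; S_x(E^{<0}_x) ⊆ E^{<0}_{f(x)}; there exist C ≥ 1 and ρ ∈ (0,1) such that ‖S^k_x w‖ ≤ C ρ^k ‖w‖ for all x ∈ M, k ∈ ℕ and w ∈ E^{<0}_x (i.e.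 E^{<0} is a uniformly contracting bundle); and there exists m ∈ ℕ such that sup{‖S^m_x w‖ : w ∈ E^{<0}_x, ‖w‖ = 1} ≤ 1/2 for all x ∈ M (i.e. the splitting ℝu ⊕ E^{<0} is dominated, since ‖S^m_x(cu)‖ = ‖cu‖ for all c). -/
open Matrix Filter Topology

/-- The average of the coordinates, as a linear functional. -/
noncomputable def coordAvg (n : ℕ) : (Fin n → ℝ) →ₗ[ℝ] ℝ :=
  (n : ℝ)⁻¹ • ∑ i : Fin n, (LinearMap.proj i : (Fin n → ℝ) →ₗ[ℝ] ℝ)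

lemma coordAvg_apply {n : ℕ} (v : Fin n → ℝ) : coordAvg n v = (n : ℝ)⁻¹ * ∑ i, v i := by
  simp [coordAvg]

lemma coordAvg_one {n : ℕ} (hn : n ≠ 0) : coordAvg n 1 = 1 := by
  have : (n : ℝ) ≠ 0 := by exact_mod_cast hn
  simp [coordAvg_apply, this]

lemma toE_add {n : ℕ} (v w : Fin n → ℝ) : toE (v + w) = toE v + toE w := rfl

lemma toE_smul {n : ℕ} (c : ℝ) (v : Fin n → ℝ) : toE (c • v) = c • toE v := rfl

lemma abs_apply_le_norm_toE {n : ℕ} (v : Fin n → ℝ) (i : Fin n) : |v i| ≤ ‖toE v‖ :=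
  PiLp.norm_apply_le (toE v) i

lemma norm_toE_mulVec_le {n : ℕ} (A : Matrix (Fin n) (Fin n) ℝ) (v : Fin n → ℝ) :
    ‖toE (A *ᵥ v)‖ ≤ opNorm A * ‖toE v‖ :=
  (LinearMap.toContinuousLinearMap (Matrix.toEuclideanLin A)).le_opNorm (toE v)

lemma Qmat_mulVec {n : ℕ} (v : Fin n → ℝ) : Qmat n *ᵥ v = v - coordAvg n v • 1 := by
  ext i
  rw [Qmat, Matrix.sub_mulVec, Matrix.one_mulVec]
  simp [Pmat, coordAvg_apply, Matrix.mulVec, dotProduct, Finset.mul_sum]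

lemma Qmat_mulVec_one {n : ℕ} (hn : n ≠ 0) : Qmat n *ᵥ 1 = 0 := by
  simp [Qmat_mulVec, coordAvg_one hn]

lemma coordAvg_smul_one_add_Qmat_mulVec {n : ℕ} (v : Fin n → ℝ) :
    coordAvg n v • 1 + Qmat n *ᵥ v = v := by
  simp [Qmat_mulVec]

lemma IsStochastic.mulVec_one {n : ℕ} {S : Matrix (Fin n) (Fin n) ℝ} (hS : IsStochastic S) :
    S *ᵥ 1 = 1 := by
  ext i
  simp [Matrix.mulVec, dotProduct, hS.2 i]

lemma IsStochastic.mulVec_eq {n : ℕ} {S : Matrix (Fin n) (Fin n) ℝ} (hS : IsStochastic S)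
    (v : Fin n → ℝ) : S *ᵥ v = coordAvg n v • 1 + S *ᵥ (Qmat n *ᵥ v) := by
  conv_lhs => rw [← coordAvg_smul_one_add_Qmat_mulVec v]
  rw [Matrix.mulVec_add, Matrix.mulVec_smul, hS.mulVec_one]

lemma IsStochastic.abs_mulVec_le {n : ℕ} {S : Matrix (Fin n) (Fin n) ℝ} (hS : IsStochastic S)
    (v : Fin n → ℝ) (i : Fin n) : |(S *ᵥ v) i| ≤ ‖toE v‖ := by
  calc |∑ j, S i j * v j| ≤ ∑ j, |S i j * v j| := Finset.abs_sum_le_sum_abs _ _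
    _ ≤ ∑ j, S i j * ‖toE v‖ := by
        refine Finset.sum_le_sum fun j _ => ?_
        rw [abs_mul, abs_of_nonneg (hS.1 i j).1]
        exact mul_le_mul_of_nonneg_left (abs_apply_le_norm_toE v j) (hS.1 i j).1
    _ = ‖toE v‖ := by rw [← Finset.sum_mul, hS.2 i, one_mul]

lemma abs_coordAvg_le {n : ℕ} (hn : n ≠ 0) {v : Fin n → ℝ} {b : ℝ} (h : ∀ i, |v i| ≤ b) :
    |coordAvg n v| ≤ b := by
  have hn' : (0 : ℝ) < n := by exact_mod_cast Nat.pos_of_ne_zero hn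
  rw [coordAvg_apply, abs_mul, abs_of_pos (inv_pos.2 hn'), inv_mul_le_iff₀ hn']
  calc |∑ i, v i| ≤ ∑ i, |v i| := Finset.abs_sum_le_sum_abs _ _
    _ ≤ ∑ _i : Fin n, b := Finset.sum_le_sum fun i _ => h i
    _ = n * b := by simp

lemma IsStochastic.Qmat_mulVec_mulVec {n : ℕ} (hn : n ≠ 0) {S : Matrix (Fin n) (Fin n) ℝ}
    (hS : IsStochastic S) (v : Fin n → ℝ) :
    Qmat n *ᵥ (S *ᵥ v) = (Qmat n * S * Qmat n) *ᵥ (Qmat n *ᵥ v) := by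
  have hQ : Qmat n *ᵥ (Qmat n *ᵥ v) = Qmat n *ᵥ v := by
    conv_rhs => rw [← coordAvg_smul_one_add_Qmat_mulVec v]
    rw [Matrix.mulVec_add, Matrix.mulVec_smul, Qmat_mulVec_one hn, smul_zero, zero_add]
  rw [← Matrix.mulVec_mulVec, ← Matrix.mulVec_mulVec, hQ, hS.mulVec_eq v, Matrix.mulVec_add,
    Matrix.mulVec_smul, Qmat_mulVec_one hn, smul_zero, zero_add]

lemma prodA_succ_mulVec {n : ℕ} (S : ℕ → Matrix (Fin n) (Fin n) ℝ) (k : ℕ) (v : Fin n → ℝ) :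
    prodA S (k + 1) *ᵥ v = S k *ᵥ (prodA S k *ᵥ v) := by
  rw [Matrix.mulVec_mulVec, prodA]

lemma prodA_mulVec_one {n : ℕ} {S : ℕ → Matrix (Fin n) (Fin n) ℝ}
    (hS : ∀ k, IsStochastic (S k)) (k : ℕ) : prodA S k *ᵥ 1 = 1 := by
  induction k with
  | zero => simp [prodA]
  | succ k ih => rw [prodA_succ_mulVec, ih, (hS k).mulVec_one]

lemma norm_Qmat_mulVec_prodA_le {n : ℕ} (hn : n ≠ 0) {S : ℕ → Matrix (Fin n) (Fin n) ℝ}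
    (hS : ∀ k, IsStochastic (S k)) {ρ : ℝ} (hρ : 0 ≤ ρ)
    (h : ∀ k, opNorm (Qmat n * S k * Qmat n) ≤ ρ) (v : Fin n → ℝ) (k : ℕ) :
    ‖toE (Qmat n *ᵥ (prodA S k *ᵥ v))‖ ≤ opNorm (Qmat n) * ‖toE v‖ * ρ ^ k := by
  induction k with
  | zero => simpa [prodA] using norm_toE_mulVec_le (Qmat n) v
  | succ k ih =>
    rw [prodA_succ_mulVec, (hS k).Qmat_mulVec_mulVec hn]
    calc _ ≤ opNorm (Qmat n * S k * Qmat n) * ‖toE (Qmat n *ᵥ (prodA S k *ᵥ v))‖ :=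
          norm_toE_mulVec_le _ _
      _ ≤ ρ * (opNorm (Qmat n) * ‖toE v‖ * ρ ^ k) :=
          mul_le_mul (h k) ih (norm_nonneg _) hρ
      _ = _ := by ring

/-- Products of stochastic matrices that uniformly contract the hyperplane of zero-sum vectors
converge exponentially fast to a rank-one map `v ↦ ℓ v • 1`. -/
lemma exists_functional_prodA_exp_close {n : ℕ} (hn : n ≠ 0)
    {S : ℕ → Matrix (Fin n) (Fin n) ℝ}
    (hS : ∀ k, IsStochastic (S k)) {ρ : ℝ} (hρ : 0 ≤ ρ) (hρ1 : ρ < 1)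
    (h : ∀ k, opNorm (Qmat n * S k * Qmat n) ≤ ρ) :
    ∃ ℓ : (Fin n → ℝ) →ₗ[ℝ] ℝ, ∀ v k, ‖toE (prodA S k *ᵥ v - ℓ v • 1)‖ ≤
      opNorm (Qmat n) * (1 + ‖toE (1 : Fin n → ℝ)‖ / (1 - ρ)) * ρ ^ k * ‖toE v‖ := by
  set K := opNorm (Qmat n)
  let a : ℕ → (Fin n → ℝ) →ₗ[ℝ] ℝ := fun k => coordAvg n ∘ₗ (prodA S k).mulVecLin
  have hstep : ∀ v k, dist (a k v) (a (k + 1) v) ≤ K * ‖toE v‖ * ρ ^ k := by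
    intro v k
    have e : a (k + 1) v =
        a k v + coordAvg n (S k *ᵥ (Qmat n *ᵥ (prodA S k *ᵥ v))) := by
      simp only [a, LinearMap.comp_apply, Matrix.mulVecLin_apply]
      rw [prodA_succ_mulVec, (hS k).mulVec_eq, map_add, map_smul, coordAvg_one hn,
        smul_eq_mul, mul_one]
    rw [e, dist_self_add_right, Real.norm_eq_abs]
    exact (abs_coordAvg_le hn ((hS k).abs_mulVec_le _)).trans
      (norm_Qmat_mulVec_prodA_le hn hS hρ h v k)
  choose L hL using fun v =>
    cauchySeq_tendsto_of_complete (cauchySeq_of_le_geometric ρ _ hρ1 (hstep v))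
  refine ⟨linearMapOfTendsto L a (tendsto_pi_nhds.2 hL), fun v k => ?_⟩
  have hd : |a k v - L v| ≤ K * ‖toE v‖ * ρ ^ k / (1 - ρ) := by
    rw [← Real.dist_eq]
    exact dist_le_of_le_geometric_of_tendsto ρ _ hρ1 (hstep v) (hL v) k
  have e : prodA S k *ᵥ v - L v • 1 =
      (a k v - L v) • (1 : Fin n → ℝ) + Qmat n *ᵥ (prodA S k *ᵥ v) := by
    conv_lhs => rw [← coordAvg_smul_one_add_Qmat_mulVec (prodA S k *ᵥ v)]
    simp only [a, LinearMap.comp_apply, Matrix.mulVecLin_apply]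
    module
  change ‖toE (prodA S k *ᵥ v - L v • 1)‖ ≤ _
  rw [e, toE_add, toE_smul]
  calc _ ≤ ‖(a k v - L v) • toE (1 : Fin n → ℝ)‖ + ‖toE (Qmat n *ᵥ (prodA S k *ᵥ v))‖ :=
        norm_add_le _ _
    _ ≤ K * ‖toE v‖ * ρ ^ k / (1 - ρ) * ‖toE (1 : Fin n → ℝ)‖ + K * ‖toE v‖ * ρ ^ k := by
        rw [norm_smul, Real.norm_eq_abs]
        exact add_le_add (mul_le_mul_of_nonneg_right hd (norm_nonneg _))
          (norm_Qmat_mulVec_prodA_le hn hS hρ h v k)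
    _ = _ := by ring

lemma cocycle_eq_prodA {n : ℕ} {X : Type*} (f : X → X) (S : X → Matrix (Fin n) (Fin n) ℝ)
    (k : ℕ) (x : X) : cocycle f S k x = prodA (fun j => S (f^[j] x)) k := by
  induction k with
  | zero => rfl
  | succ k ih => rw [cocycle, prodA, ih]

lemma cocycle_succ' {n : ℕ} {X : Type*} (f : X → X) (S : X → Matrix (Fin n) (Fin n) ℝ)
    (k : ℕ) (x : X) : cocycle f S (k + 1) x = cocycle f S k (f x) * S x := by
  induction k with
  | zero => simp [cocycle]
  | succ k ih => rw [cocycle, ih, cocycle, Matrix.mul_assoc, Function.iterate_succ_apply]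

/-- A sequence bounded by a decaying exponential has negative upper exponential growth rate. -/
lemma limsup_inv_mul_elog_neg {r : ℕ → ℝ} {D ρ : ℝ} (hρ : 0 < ρ) (hρ1 : ρ < 1)
    (h : ∀ k, r k ≤ D * ρ ^ k) :
    limsup (fun k : ℕ => (((k : ℝ)⁻¹ : ℝ) : EReal) * elog (r k)) atTop < 0 := by
  have hlog : Real.log ρ < 0 := Real.log_neg hρ hρ1
  have hD : ∀ᶠ k : ℕ in atTop, (k : ℝ)⁻¹ * Real.log (max D 1) < -(Real.log ρ / 2) := by
    have : Tendsto (fun k : ℕ => (k : ℝ)⁻¹ * Real.log (max D 1)) atTop (𝓝 0) := by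
      simpa using (tendsto_inv_atTop_nhds_zero_nat (𝕜 := ℝ)).mul_const (Real.log (max D 1))
    exact this.eventually_lt_const (by linarith)
  have hle : limsup (fun k : ℕ => (((k : ℝ)⁻¹ : ℝ) : EReal) * elog (r k)) atTop ≤
      ((Real.log ρ / 2 : ℝ) : EReal) := by
    refine limsup_le_of_le (h := ?_)
    filter_upwards [hD, eventually_gt_atTop 0] with k hk hk0
    have hk0' : (0 : ℝ) < k := by exact_mod_cast hk0
    by_cases hr : r k ≤ 0
    · rw [elog, if_pos hr, EReal.coe_mul_bot_of_pos (inv_pos.2 hk0')]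
      exact bot_le
    · rw [elog, if_neg hr, ← EReal.coe_mul, EReal.coe_le_coe_iff]
      push Not at hr
      have h1 : Real.log (r k) ≤ Real.log (max D 1) + k * Real.log ρ := by
        rw [← Real.log_pow, ← Real.log_mul (by positivity) (by positivity)]
        refine Real.log_le_log hr ((h k).trans ?_)
        gcongr
        exact le_max_left _ _
      have h2 := mul_le_mul_of_nonneg_left h1 (inv_pos.2 hk0').le
      rw [mul_add, inv_mul_cancel_left₀ hk0'.ne'] at h2
      linarith
  refine hle.trans_lt ?_
  exact_mod_cast (by linarith : Real.log ρ / 2 < 0)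

/-- A nonnegative sequence with negative upper exponential growth rate tends to zero. -/
lemma tendsto_zero_of_limsup_inv_mul_elog_neg {r : ℕ → ℝ} (hr : ∀ k, 0 ≤ r k)
    (h : limsup (fun k : ℕ => (((k : ℝ)⁻¹ : ℝ) : EReal) * elog (r k)) atTop < 0) :
    Tendsto r atTop (𝓝 0) := by
  obtain ⟨c, hc, hc0⟩ := EReal.lt_iff_exists_real_btwn.1 h
  have hc0' : c < 0 := by exact_mod_cast hc0
  have hexp : Tendsto (fun k : ℕ => Real.exp c ^ k) atTop (𝓝 0) :=
    tendsto_pow_atTop_nhds_zero_of_lt_one (Real.exp_pos c).le (Real.exp_lt_one_iff.2 hc0')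
  refine tendsto_of_tendsto_of_tendsto_of_le_of_le' tendsto_const_nhds hexp
    (Eventually.of_forall hr) ?_
  filter_upwards [eventually_lt_of_limsup_lt hc, eventually_gt_atTop 0] with k hk hk0
  have hk0' : (0 : ℝ) < k := by exact_mod_cast hk0
  by_cases h0 : r k ≤ 0
  · exact h0.trans (by positivity)
  · rw [elog, if_neg h0, ← EReal.coe_mul, EReal.coe_lt_coe_iff, inv_mul_lt_iff₀ hk0'] at hk
    push Not at h0
    rw [← Real.exp_nat_mul]
    exact ((Real.log_lt_iff_lt_exp h0).1 hk).le

lemma uvec_eq_smul_one (n : ℕ) : uvec n = (1 / Real.sqrt n) • (1 : Fin n → ℝ) := by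
  ext i
  simp [uvec]

/-- Over a compact metric space with a homeomorphism `f` and continuous
`S : M → 𝒮ⁿ` satisfying `sup_x ‖Q S_x Q‖ < 1`, the sets
`E^{<0}_x = {v : limsup (1/k) log‖S^k_x v‖ < 0}` form a family of `(n−1)`-dimensional
subspaces complementary to `ℝu`, invariant, uniformly contracting, and the splitting
`ℝu ⊕ E^{<0}` is dominated. -/
theorem stmt5 {n : ℕ} (hn : 2 ≤ n) {M : Type*} [MetricSpace M] [CompactSpace M]
    (f : M ≃ₜ M) (S : M → Matrix (Fin n) (Fin n) ℝ) (hScont : Continuous S)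
    (hS : ∀ x, IsStochastic (S x))
    (hsup : ∃ ρ < (1:ℝ), ∀ x, opNorm (Qmat n * S x * Qmat n) ≤ ρ) :
    ∃ E : M → Submodule ℝ (Fin n → ℝ),
      -- `E x` is exactly the set `E^{<0}_x` (hence the latter is a linear subspace)
      (∀ x, (E x : Set (Fin n → ℝ)) =
        {v | Filter.limsup (fun k : ℕ => (((k : ℝ)⁻¹ : ℝ) : EReal) *
          elog ‖toE ((cocycle (⇑f) S k x).mulVec v)‖) atTop < 0}) ∧
      (∀ x, Module.finrank ℝ (E x) = n - 1) ∧
      (∀ x, IsCompl (Submodule.span ℝ {uvec n}) (E x)) ∧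
      (∀ x, (E x).map (Matrix.mulVecLin (S x)) ≤ E (f x)) ∧
      -- uniformly contracting bundle
      (∃ C : ℝ, 1 ≤ C ∧ ∃ ρ ∈ Set.Ioo (0:ℝ) 1, ∀ x, ∀ k : ℕ, ∀ w ∈ E x,
        ‖toE ((cocycle (⇑f) S k x).mulVec w)‖ ≤ C * ρ ^ k * ‖toE w‖) ∧
      -- domination of `ℝu ⊕ E^{<0}`
      (∃ m : ℕ, ∀ x, ∀ w ∈ E x, ‖toE w‖ = 1 →
        ‖toE ((cocycle (⇑f) S m x).mulVec w)‖ ≤ 1/2) := by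
  have hn0 : n ≠ 0 := by omega
  obtain ⟨ρ, hρ, hρ1, hop⟩ : ∃ ρ : ℝ, 0 < ρ ∧ ρ < 1 ∧
      ∀ x, opNorm (Qmat n * S x * Qmat n) ≤ ρ := by
    obtain ⟨ρ, hρ1, h⟩ := hsup
    exact ⟨max ρ (1 / 2), by positivity, max_lt hρ1 (by norm_num),
      fun x => (h x).trans (le_max_left _ _)⟩
  have hex := fun x => exists_functional_prodA_exp_close hn0
    (S := fun j => S (f^[j] x)) (fun j => hS _) hρ.le hρ1 (fun j => hop _)
  simp only [← cocycle_eq_prodA] at hex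
  choose ℓ hℓ using hex
  set C := opNorm (Qmat n) * (1 + ‖toE (1 : Fin n → ℝ)‖ / (1 - ρ))
  have hlim : ∀ x v,
      Tendsto (fun k => ‖toE (cocycle f S k x *ᵥ v - ℓ x v • 1)‖) atTop (𝓝 0) := by
    intro x v
    refine squeeze_zero (fun k => norm_nonneg _) (hℓ x v) ?_
    simpa using ((tendsto_pow_atTop_nhds_zero_of_lt_one hρ.le hρ1).const_mul C).mul_const ‖toE v‖
  have huniq : ∀ x v (c : ℝ),
      Tendsto (fun k => ‖toE (cocycle f S k x *ᵥ v - c • 1)‖) atTop (𝓝 0) → ℓ x v = c := by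
    intro x v c hc
    have i : Fin n := ⟨0, by omega⟩
    have hcoord : ∀ b : ℝ,
        Tendsto (fun k => ‖toE (cocycle f S k x *ᵥ v - b • 1)‖) atTop (𝓝 0) →
        Tendsto (fun k => (cocycle f S k x *ᵥ v) i) atTop (𝓝 b) := by
      intro b hb
      rw [tendsto_iff_norm_sub_tendsto_zero]
      refine squeeze_zero (fun k => norm_nonneg _) (fun k => ?_) hb
      simpa [Pi.sub_apply, Pi.smul_apply] using
        abs_apply_le_norm_toE (cocycle f S k x *ᵥ v - b • (1 : Fin n → ℝ)) i
    exact tendsto_nhds_unique (hcoord _ (hlim x v)) (hcoord c hc)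
  have hone : ∀ x, ℓ x 1 = 1 := by
    intro x
    refine huniq x 1 1 ?_
    have : ∀ k, cocycle f S k x *ᵥ 1 = 1 := fun k => by
      rw [cocycle_eq_prodA]
      exact prodA_mulVec_one (fun j => hS _) k
    simp [this, toE]
  have hinv : ∀ x v, ℓ (f x) (S x *ᵥ v) = ℓ x v := by
    intro x v
    refine huniq _ _ _ ?_
    simpa [cocycle_succ', Function.comp_def] using (hlim x v).comp (tendsto_add_atTop_nat 1)
  have hcontr : ∀ x, ∀ k : ℕ, ∀ w ∈ LinearMap.ker (ℓ x),
      ‖toE (cocycle f S k x *ᵥ w)‖ ≤ max C 1 * ρ ^ k * ‖toE w‖ := by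
    intro x k w hw
    have := hℓ x w k
    rw [LinearMap.mem_ker.1 hw, zero_smul, sub_zero] at this
    refine this.trans ?_
    gcongr
    exact le_max_left _ _
  have hu : ∀ x, ℓ x (uvec n) ≠ 0 := by
    intro x
    have : (0 : ℝ) < n := by exact_mod_cast Nat.pos_of_ne_zero hn0
    rw [uvec_eq_smul_one, map_smul, hone, smul_eq_mul, mul_one]
    positivity
  have hne : ∀ x, ℓ x ≠ 0 := fun x h => hu x (by simp [h])
  refine ⟨fun x => LinearMap.ker (ℓ x), fun x => ?_, fun x => ?_, fun x => ?_, fun x => ?_,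
    ⟨max C 1, le_max_right _ _, ρ, ⟨hρ, hρ1⟩, hcontr⟩, ?_⟩
  · ext v
    refine ⟨fun hv => ?_, fun hv => ?_⟩
    · refine limsup_inv_mul_elog_neg (D := max C 1 * ‖toE v‖) hρ hρ1 fun k => ?_
      exact (hcontr x k v hv).trans_eq (by ring)
    · refine LinearMap.mem_ker.2 (huniq x v 0 ?_)
      simpa using tendsto_zero_of_limsup_inv_mul_elog_neg (fun k => norm_nonneg _) hv
  · have := Module.Dual.finrank_ker_add_one_of_ne_zero (hne x)
    rw [Module.finrank_fin_fun] at this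
    exact Nat.eq_sub_of_add_eq this
  · exact (Submodule.isCompl_span_singleton_of_isCoatom_of_notMem
      (LinearMap.isCoatom_ker_of_surjective (LinearMap.surjective (hne x))) (hu x)).symm
  · rintro _ ⟨v, hv, rfl⟩
    exact LinearMap.mem_ker.2 ((hinv x v).trans hv)
  · have ht : Tendsto (fun m : ℕ => max C 1 * ρ ^ m) atTop (𝓝 0) := by
      simpa using (tendsto_pow_atTop_nhds_zero_of_lt_one hρ.le hρ1).const_mul (max C 1)
    obtain ⟨m, hm⟩ := (ht.eventually_lt_const (by norm_num : (0 : ℝ) < 1 / 2)).exists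
    refine ⟨m, fun x w hw hw1 => (hcontr x m w hw).trans ?_⟩
    rw [hw1, mul_one]
    exact hm.le
end

section
/- Let S_1, …, S_k be n×n row-stochastic matrices and ρ ∈ ℝ. Then (P + ρ S_k Q)(P + ρ S_{k−1} Q)⋯(P + ρ S_1 Q) = P + Σ_{j=1}^{k} ρ^j · P (S_j Q)(S_{j−1} Q)⋯(S_1 Q) + ρ^k · (Q S_k Q)(Q S_{k−1} Q)⋯(Q S_1 Q). -/
open Matrix Filter Topology

lemma Pmat_mul_Pmat (n : ℕ) : Pmat n * Pmat n = Pmat n := by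
  ext i j
  have hn : (n : ℝ) ≠ 0 := Nat.cast_ne_zero.mpr i.pos.ne'
  simp [Pmat, Matrix.mul_apply, hn]

lemma Pmat_mul_Qmat (n : ℕ) : Pmat n * Qmat n = 0 := by
  simp [Qmat, mul_sub, Pmat_mul_Pmat]

lemma Qmat_mul_Pmat (n : ℕ) : Qmat n * Pmat n = 0 := by
  simp [Qmat, sub_mul, Pmat_mul_Pmat]

lemma Qmat_mul_Qmat (n : ℕ) : Qmat n * Qmat n = Qmat n := by
  conv_lhs => rw [Qmat, sub_mul, ← Qmat, Pmat_mul_Qmat]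
  simp

lemma Pmat_add_Qmat (n : ℕ) : Pmat n + Qmat n = 1 := by
  simp [Qmat]

/-- Only the leftmost `Q` in a nonempty product of compressions `Q S_i Q` matters. -/
lemma prodA_Qmat_mul_mul_Qmat {n : ℕ} (S : ℕ → Matrix (Fin n) (Fin n) ℝ) (k : ℕ) :
    prodA (fun i => Qmat n * S i * Qmat n) (k + 1)
      = Qmat n * prodA (fun i => S i * Qmat n) (k + 1) := by
  induction k with
  | zero => simp [prodA, mul_assoc]
  | succ k ih =>
    rw [prodA, ih, prodA.eq_2 (fun i => S i * Qmat n) (k + 1)]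
    simp only [mul_assoc]
    rw [← mul_assoc (Qmat n) (Qmat n), Qmat_mul_Qmat]

/-- The expansion of the product holds for arbitrary matrices. -/
lemma prodA_Pmat_add_smul {n : ℕ} (S : ℕ → Matrix (Fin n) (Fin n) ℝ) (ρ : ℝ) (k : ℕ) :
    prodA (fun i => Pmat n + ρ • (S i * Qmat n)) (k + 1)
      = Pmat n
        + ∑ j ∈ Finset.range (k + 1),
            ρ ^ (j + 1) • (Pmat n * prodA (fun i => S i * Qmat n) (j + 1))
        + ρ ^ (k + 1) • (Qmat n * prodA (fun i => S i * Qmat n) (k + 1)) := by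
  have split (A : Matrix (Fin n) (Fin n) ℝ) : A = Pmat n * A + Qmat n * A := by
    rw [← add_mul, Pmat_add_Qmat, one_mul]
  induction k with
  | zero =>
    simp only [prodA, mul_one, zero_add, Finset.range_one, Finset.sum_singleton, pow_one]
    rw [add_assoc, ← smul_add, ← split]
  | succ k ih =>
    have hP (A : Matrix (Fin n) (Fin n) ℝ) : Pmat n * (Pmat n * A) = Pmat n * A := by
      rw [← mul_assoc, Pmat_mul_Pmat]
    have hPQ (A : Matrix (Fin n) (Fin n) ℝ) : Pmat n * (Qmat n * A) = 0 := by
      rw [← mul_assoc, Pmat_mul_Qmat, zero_mul]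
    have hQP (A : Matrix (Fin n) (Fin n) ℝ) : Qmat n * (Pmat n * A) = 0 := by
      rw [← mul_assoc, Qmat_mul_Pmat, zero_mul]
    have hQ (A : Matrix (Fin n) (Fin n) ℝ) : Qmat n * (Qmat n * A) = Qmat n * A := by
      rw [← mul_assoc, Qmat_mul_Qmat]
    rw [prodA, ih, Finset.sum_range_succ _ (k + 1), prodA.eq_2 (fun i => S i * Qmat n) (k + 1)]
    generalize prodA (fun i => S i * Qmat n) (k + 1) = T
    simp only [add_mul, mul_add, Finset.mul_sum, mul_smul_comm, smul_mul_assoc, mul_assoc,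
      hP, hPQ, hQP, hQ, Pmat_mul_Pmat, Qmat_mul_Pmat, mul_zero, smul_zero,
      add_zero, zero_add]
    simp only [add_assoc, smul_smul, ← pow_succ]
    rw [← smul_add (ρ ^ (k + 2)), ← split]

/-- For stochastic matrices `S_1, …, S_k` (here `S i` with `S 0 = S_1`)
and `ρ ∈ ℝ`,
`(P + ρ S_k Q)⋯(P + ρ S_1 Q) = P + ∑_{j=1}^k ρ^j · P (S_j Q)⋯(S_1 Q) + ρ^k (Q S_k Q)⋯(Q S_1 Q)`. -/
theorem stmt7 {n k : ℕ} (hk : 0 < k) (S : ℕ → Matrix (Fin n) (Fin n) ℝ)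
    (hS : ∀ i < k, IsStochastic (S i)) (ρ : ℝ) :
    prodA (fun i => Pmat n + ρ • (S i * Qmat n)) k
      = Pmat n
        + ∑ j ∈ Finset.range k,
            ρ ^ (j + 1) • (Pmat n * prodA (fun i => S i * Qmat n) (j + 1))
        + ρ ^ k • prodA (fun i => Qmat n * S i * Qmat n) k := by
  obtain ⟨k, rfl⟩ := Nat.exists_eq_succ_of_ne_zero hk.ne'
  rw [prodA_Qmat_mul_mul_Qmat]
  exact prodA_Pmat_add_smul S ρ k
end

section
/- Let S be a non-invertible n×n row-stochastic matrix and ε > 0. Then there exists a row-stochastic matrix T with rank(T) = rank(S) + 1 and ‖S − T‖ < ε (operator norm); indeed T can be obtained from S by replacing a single row. -/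
open Matrix Filter Topology

/-- Adjoining to a finite-dimensional subspace a vector outside it raises the dimension by one. -/
theorem finrank_span_insert_of_notMem {K E : Type*} [Field K] [AddCommGroup E] [Module K E]
    [FiniteDimensional K E] {s : Set E} {v : E} (hv : v ∉ Submodule.span K s) :
    Module.finrank K (Submodule.span K (insert v s)) =
      Module.finrank K (Submodule.span K s) + 1 := by
  have hv0 : v ≠ 0 := fun h => hv (h ▸ Submodule.zero_mem _)
  have hdisj : K ∙ v ⊓ Submodule.span K s = ⊥ :=
    disjoint_iff.mp ((Submodule.disjoint_span_singleton' hv0).mpr hv).symm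
  have h := Submodule.finrank_sup_add_finrank_inf_eq (K ∙ v) (Submodule.span K s)
  rw [hdisj, finrank_bot, finrank_span_singleton hv0] at h
  rw [Submodule.span_insert]
  omega

/-- The range of a family is the value at an index together with the values at the others. -/
theorem insert_image_compl_singleton {ι α : Type*} (f : ι → α) (l : ι) :
    insert (f l) (f '' {l}ᶜ) = Set.range f := by
  rw [← Set.image_insert_eq, Set.insert_eq, Set.union_compl_self, Set.image_univ]

/-- Replacing a row lying in the span of the other rows by a vector outside that span raises the
rank by one. -/
theorem rank_updateRow_of_notMem_span {n : ℕ} {S : Matrix (Fin n) (Fin n) ℝ} {l : Fin n}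
    {v : Fin n → ℝ} (hl : S.row l ∈ Submodule.span ℝ (S.row '' {l}ᶜ))
    (hv : v ∉ Submodule.span ℝ (S.row '' {l}ᶜ)) :
    (S.updateRow l v).rank = S.rank + 1 := by
  have himage : (S.updateRow l v).row '' {l}ᶜ = S.row '' {l}ᶜ :=
    Set.image_congr fun i hi => Matrix.updateRow_ne hi
  have hrank : ∀ A : Matrix (Fin n) (Fin n) ℝ,
      A.rank = Module.finrank ℝ (Submodule.span ℝ (insert (A.row l) (A.row '' {l}ᶜ))) := fun A => by
    rw [insert_image_compl_singleton]
    exact A.rank_eq_finrank_span_row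
  have hrow : (S.updateRow l v).row l = v := Matrix.updateRow_self
  rw [hrank, hrank S, himage, hrow, finrank_span_insert_of_notMem hv,
    Submodule.span_insert_eq_span hl]

/-- A proper subspace of `ℝⁿ` misses some standard basis vector. -/
theorem exists_single_notMem_of_ne_top {n : ℕ} {V : Submodule ℝ (Fin n → ℝ)} (hV : V ≠ ⊤) :
    ∃ j, (Pi.single j 1 : Fin n → ℝ) ∉ V := by
  by_contra! h
  refine hV (eq_top_iff.mpr ?_)
  rw [← (Pi.basisFun ℝ (Fin n)).span_eq, Submodule.span_le]
  rintro _ ⟨j, rfl⟩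
  simpa using h j

/-- Replacing a row of a stochastic matrix by a probability vector gives a stochastic matrix. -/
theorem IsStochastic.updateRow {n : ℕ} {S : Matrix (Fin n) (Fin n) ℝ} (hS : IsStochastic S)
    (l : Fin n) {v : Fin n → ℝ} (hv : v ∈ stdSimplex ℝ (Fin n)) :
    IsStochastic (S.updateRow l v) := by
  refine ⟨fun i j => ?_, fun i => ?_⟩ <;> rcases eq_or_ne i l with rfl | hi
  · rw [Matrix.updateRow_self]
    exact mem_Icc_of_mem_stdSimplex hv j
  · rw [Matrix.updateRow_ne hi]
    exact hS.1 i j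
  · simpa only [Matrix.updateRow_self] using hv.2
  · simpa only [Matrix.updateRow_ne hi] using hS.2 i

theorem opNorm_nonneg {n : ℕ} (A : Matrix (Fin n) (Fin n) ℝ) : 0 ≤ opNorm A :=
  norm_nonneg _

theorem opNorm_smul {n : ℕ} (t : ℝ) (A : Matrix (Fin n) (Fin n) ℝ) :
    opNorm (t • A) = |t| * opNorm A := by
  rw [opNorm, opNorm, map_smul, map_smul, norm_smul, Real.norm_eq_abs]

/-- A non-invertible stochastic matrix `S` can be `ε`-approximated
(operator norm) by a stochastic matrix `T` of rank `rank S + 1` differing from `S`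
in a single row. -/
theorem stmt10 {n : ℕ} (S : Matrix (Fin n) (Fin n) ℝ) (hS : IsStochastic S)
    (hSnotinv : ¬ IsUnit S) (ε : ℝ) (hε : 0 < ε) :
    ∃ T : Matrix (Fin n) (Fin n) ℝ, IsStochastic T ∧ T.rank = S.rank + 1 ∧
      opNorm (S - T) < ε ∧ ∃ l : Fin n, ∀ i, i ≠ l → T i = S i := by
  obtain ⟨l, hl⟩ : ∃ l, S.row l ∈ Submodule.span ℝ (S.row '' {l}ᶜ) := by
    by_contra! h
    refine hSnotinv (Matrix.linearIndependent_rows_iff_isUnit.mp ?_)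
    rw [linearIndependent_iff_notMem_span]
    intro i
    rw [← Set.compl_eq_univ_sdiff]
    exact h i
  set V := Submodule.span ℝ (S.row '' {l}ᶜ)
  have hV : V ≠ ⊤ := by
    intro htop
    refine hSnotinv (Matrix.linearIndependent_rows_iff_isUnit.mp ?_)
    refine linearIndependent_of_top_le_span_of_card_eq_finrank ?_ (by simp)
    rw [← htop]
    exact Submodule.span_mono (Set.image_subset_range _ _)
  obtain ⟨j, hj⟩ := exists_single_notMem_of_ne_top hV
  set e : Fin n → ℝ := Pi.single j 1
  set D := S - S.updateRow l e with hD
  have hN := opNorm_nonneg D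
  set t := ε / (ε + opNorm D) with ht
  have ht0 : 0 < t := by positivity
  have ht1 : t ≤ 1 := div_le_one_of_le₀ (by linarith) (by positivity)
  refine ⟨S.updateRow l ((1 - t) • S.row l + t • e), hS.updateRow l ?_,
    rank_updateRow_of_notMem_span hl ?_, ?_, l, fun i hi => Matrix.updateRow_ne hi⟩
  · exact convex_stdSimplex ℝ (Fin n) ⟨fun k => (hS.1 l k).1, hS.2 l⟩
      (single_mem_stdSimplex ℝ j) (by linarith) ht0.le (by ring)
  · rwa [Submodule.add_mem_iff_right _ (V.smul_mem _ hl), V.smul_mem_iff ht0.ne']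
  · have hdiff : S - S.updateRow l ((1 - t) • S.row l + t • e) = t • D := by
      ext i k
      rcases eq_or_ne i l with rfl | hi
      · simp [hD]
        ring
      · simp [hD, Matrix.updateRow_ne hi]
    rw [hdiff, opNorm_smul, abs_of_pos ht0, ht, div_mul_eq_mul_div, div_lt_iff₀ (by positivity)]
    nlinarith
end

section
/- With 𝒜 := {A ∈ M_{n×n}(ℝ) : every row sum and every column sum of A is 0}, one has the set identity {QS : S ∈ 𝒮ⁿ} = {A = (a_{ij}) ∈ 𝒜 : Σ_{j=1}^n min_{i=1,…,n} a_{ij} ≥ −1}. -/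
open Matrix Filter Topology

theorem Qmat_mul_apply {n : ℕ} (S : Matrix (Fin n) (Fin n) ℝ) (i j : Fin n) :
    (Qmat n * S) i j = S i j - (∑ k, S k j) / n := by
  have hP : (Pmat n * S) i j = (∑ k, S k j) / n := by
    simp only [Pmat, Matrix.mul_apply, Matrix.of_apply]
    rw [← Finset.mul_sum, one_div_mul_eq_div]
  rw [Qmat, Matrix.sub_mul, Matrix.one_mul, Matrix.sub_apply, hP]

theorem sum_column_means_of_isStochastic {n : ℕ} (hn : n ≠ 0) {S : Matrix (Fin n) (Fin n) ℝ}
    (hS : IsStochastic S) : ∑ j, (∑ k, S k j) / (n : ℝ) = 1 := by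
  rw [← Finset.sum_div, Finset.sum_comm]
  simp [hS.2, hn]

/-- Nonnegativity and unit row sums already force the entries to be at most `1`. -/
theorem isStochastic_of_nonneg {n : ℕ} {S : Matrix (Fin n) (Fin n) ℝ}
    (h₀ : ∀ i j, 0 ≤ S i j) (h₁ : ∀ i, ∑ j, S i j = 1) : IsStochastic S :=
  ⟨fun i j => ⟨h₀ i j, h₁ i ▸ Finset.single_le_sum (f := S i) (fun k _ => h₀ i k)
    (Finset.mem_univ j)⟩, h₁⟩

/-- The image `{QS : S ∈ 𝒮ⁿ}` equals the set of matrices with all row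
and column sums `0` satisfying `∑_j min_i a_{ij} ≥ −1`. -/
theorem stmt12 {n : ℕ} :
    {A : Matrix (Fin n) (Fin n) ℝ | ∃ S, IsStochastic S ∧ A = Qmat n * S} =
    {A : Matrix (Fin n) (Fin n) ℝ |
      ((∀ i, ∑ j, A i j = 0) ∧ (∀ j, ∑ i, A i j = 0)) ∧
      -1 ≤ ∑ j, ⨅ i, A i j} := by
  obtain rfl | hn := eq_or_ne n 0
  · ext A
    simp only [Set.mem_ofPred_eq]
    exact ⟨fun _ => by simp, fun _ => ⟨A, by simp [IsStochastic], Subsingleton.elim _ _⟩⟩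
  have hn' : (n : ℝ) ≠ 0 := Nat.cast_ne_zero.mpr hn
  have : Nonempty (Fin n) := ⟨⟨0, Nat.pos_of_ne_zero hn⟩⟩
  ext A
  simp only [Set.mem_ofPred_eq]
  constructor
  · rintro ⟨S, hS, rfl⟩
    have hmean := sum_column_means_of_isStochastic hn hS
    refine ⟨⟨fun i => ?_, fun j => ?_⟩, ?_⟩
    · simp only [Qmat_mul_apply, Finset.sum_sub_distrib, hS.2 i, hmean, sub_self]
    · simp only [Qmat_mul_apply, Finset.sum_sub_distrib, Finset.sum_const, Finset.card_univ,
        Fintype.card_fin, nsmul_eq_mul]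
      rw [mul_div_cancel₀ _ hn', sub_self]
    · rw [← hmean, ← Finset.sum_neg_distrib]
      refine Finset.sum_le_sum fun j _ => le_ciInf fun i => ?_
      rw [Qmat_mul_apply]
      linarith [(hS.1 i j).1]
  · rintro ⟨⟨hrow, hcol⟩, hmin⟩
    set μ : Fin n → ℝ := fun j => ⨅ i, A i j
    have hle (i j) : μ j ≤ A i j := ciInf_le (Set.finite_range _).bddBelow i
    set δ : ℝ := (1 + ∑ j, μ j) / n
    have hδ₀ : 0 ≤ δ := div_nonneg (by linarith) (Nat.cast_nonneg n)
    have hnδ : (n : ℝ) * δ = 1 + ∑ j, μ j := mul_div_cancel₀ _ hn'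
    refine ⟨Matrix.of fun i j => A i j - μ j + δ,
      isStochastic_of_nonneg (fun i j => ?_) (fun i => ?_), ?_⟩
    · rw [Matrix.of_apply]
      linarith [hle i j]
    · simp only [Matrix.of_apply, Finset.sum_add_distrib, Finset.sum_sub_distrib, hrow,
        Finset.sum_const, Finset.card_univ, Fintype.card_fin, nsmul_eq_mul, hnδ]
      ring
    · ext i j
      simp only [Qmat_mul_apply, Matrix.of_apply, Finset.sum_add_distrib, Finset.sum_sub_distrib,
        hcol, Finset.sum_const, Finset.card_univ, Fintype.card_fin, nsmul_eq_mul]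
      field_simp
      ring
end

section
/- Let ε ∈ [0,1] and v, w ∈ ℝⁿ, and write α(v) = min_j v_j and β(v) = max_j v_j. Then there exists an n×n row-stochastic matrix S = (s_{ij}) with max_{i,j} |s_{ij} − δ_{ij}| ≤ ε and S v = w if and only if for every i ∈ {1,…,n}: ε·(α(v) − v_i) ≤ w_i − v_i ≤ ε·(β(v) − v_i). -/
open Matrix Filter Topology

/-- A weighted average of `v` giving weight at least `1 - ε` to the index `i` exceeds `v i` by at
most `ε` times the gap between `v i` and an upper bound of `v`. -/
lemma sum_mul_sub_le_of_one_sub_le {ι : Type*} [Fintype ι] {ε b : ℝ} {p v : ι → ℝ} {i : ι}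
    (hp : ∀ j, 0 ≤ p j) (hsum : ∑ j, p j = 1) (hi : 1 - ε ≤ p i) (hb : ∀ j, v j ≤ b) :
    ∑ j, p j * v j - v i ≤ ε * (b - v i) := by
  have hgap : p i * (b - v i) ≤ ∑ j, p j * (b - v j) :=
    Finset.single_le_sum (f := fun j => p j * (b - v j))
      (fun j _ => mul_nonneg (hp j) (sub_nonneg.2 (hb j))) (Finset.mem_univ i)
  have hexp : ∑ j, p j * (b - v j) = b - ∑ j, p j * v j := by
    simp only [mul_sub, Finset.sum_sub_distrib, ← Finset.sum_mul, hsum, one_mul]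
  have := mul_le_mul_of_nonneg_right hi (sub_nonneg.2 (hb i))
  linarith

/-- A number between `v i + ε (v a - v i)` and `v i + ε (v b - v i)` is a weighted average of `v`
whose weights differ by at most `ε` from the point mass at `i`. -/
lemma exists_weights_near_single {ι : Type*} [Fintype ι] [DecidableEq ι] {ε y : ℝ}
    (hε₀ : 0 ≤ ε) (hε₁ : ε ≤ 1) {v : ι → ℝ} {i a b : ι}
    (ha : ε * (v a - v i) ≤ y - v i) (hb : y - v i ≤ ε * (v b - v i)) :
    ∃ p : ι → ℝ, (∀ j, 0 ≤ p j ∧ p j ≤ 1) ∧ ∑ j, p j = 1 ∧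
      (∀ j, |p j - if i = j then 1 else 0| ≤ ε) ∧ ∑ j, p j * v j = y := by
  obtain ⟨s, t, hs, ht, hst, hy⟩ :
      y - v i ∈ segment ℝ (ε * (v a - v i)) (ε * (v b - v i)) := by
    rw [segment_eq_Icc (ha.trans hb)]
    exact ⟨ha, hb⟩
  simp only [smul_eq_mul] at hy
  let c : ι → ℝ := fun j => s * (if a = j then 1 else 0) + t * (if b = j then 1 else 0)
  have hc₀ : ∀ j, 0 ≤ c j := fun j => by simp only [c]; positivity
  have hc₁ : ∀ j, c j ≤ 1 := fun j => by simp only [c]; split_ifs <;> linarith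
  refine ⟨fun j => (1 - ε) * (if i = j then 1 else 0) + ε * c j, fun j => ?_, ?_, fun j => ?_, ?_⟩
  · have h₀ := mul_nonneg hε₀ (hc₀ j)
    have h₁ := mul_le_mul_of_nonneg_left (hc₁ j) hε₀
    constructor <;> beta_reduce <;> split_ifs <;> linarith
  · simp [c, Finset.sum_add_distrib, ← Finset.mul_sum, hst]
  · have h₀ := mul_nonneg hε₀ (hc₀ j)
    have h₁ := mul_le_mul_of_nonneg_left (hc₁ j) hε₀
    rw [abs_le]
    constructor <;> beta_reduce <;> split_ifs <;> linarith
  · have hcv : ∑ j, c j * v j = s * v a + t * v b := by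
      simp [c, add_mul, Finset.sum_add_distrib]
    have hsum : ∑ j, ((1 - ε) * (if i = j then 1 else 0) + ε * c j) * v j
        = (1 - ε) * v i + ε * ∑ j, c j * v j := by
      simp [add_mul, mul_assoc, Finset.sum_add_distrib, ← Finset.mul_sum]
    rw [hsum, hcv]
    linear_combination hy + ε * v i * hst

/-- For `ε ∈ [0,1]` and `v, w ∈ ℝⁿ`, there exists a stochastic matrix `S`
with `max_{i,j} |s_{ij} − δ_{ij}| ≤ ε` and `S v = w` if and only if for every `i`,
`ε·(α(v) − vᵢ) ≤ wᵢ − vᵢ ≤ ε·(β(v) − vᵢ)`, where `α(v) = minⱼ vⱼ` and `β(v) = maxⱼ vⱼ`. -/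
theorem stmt13 {n : ℕ} (ε : ℝ) (hε : ε ∈ Set.Icc (0:ℝ) 1) (v w : Fin n → ℝ) :
    (∃ S : Matrix (Fin n) (Fin n) ℝ, IsStochastic S ∧
      (∀ i j, |S i j - if i = j then 1 else 0| ≤ ε) ∧ S.mulVec v = w) ↔
    (∀ i, ε * ((⨅ j, v j) - v i) ≤ w i - v i ∧ w i - v i ≤ ε * ((⨆ j, v j) - v i)) := by
  constructor
  · rintro ⟨S, ⟨hS, hsum⟩, hclose, rfl⟩ i
    have hi : 1 - ε ≤ S i i := by
      have := (abs_le.1 (hclose i i)).1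
      rw [if_pos rfl] at this
      linarith
    have hupper := sum_mul_sub_le_of_one_sub_le (fun j => (hS i j).1) (hsum i) hi
      (fun j => le_ciSup (Set.finite_range v).bddAbove j)
    have hlower := sum_mul_sub_le_of_one_sub_le (v := -v) (fun j => (hS i j).1) (hsum i) hi
      (fun j => neg_le_neg (ciInf_le (Set.finite_range v).bddBelow j))
    simp only [Pi.neg_apply, mul_neg, Finset.sum_neg_distrib] at hlower
    simp only [mulVec, dotProduct]
    exact ⟨by linarith, hupper⟩
  · intro h
    have hrow : ∀ i, ∃ p : Fin n → ℝ, (∀ j, 0 ≤ p j ∧ p j ≤ 1) ∧ ∑ j, p j = 1 ∧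
        (∀ j, |p j - if i = j then 1 else 0| ≤ ε) ∧ ∑ j, p j * v j = w i := by
      intro i
      have : Nonempty (Fin n) := ⟨i⟩
      obtain ⟨a, ha⟩ := exists_eq_ciInf_of_finite (f := v)
      obtain ⟨b, hb⟩ := exists_eq_ciSup_of_finite (f := v)
      exact exists_weights_near_single hε.1 hε.2 (ha ▸ (h i).1) (hb ▸ (h i).2)
    choose S hS hsum hclose hmul using hrow
    exact ⟨S, ⟨hS, hsum⟩, hclose, funext hmul⟩
end

section
/- Let n ≥ 2 and let v = (v₁,…,vₙ) ∈ ℝⁿ satisfy Σᵢ vᵢ = 0 and ‖v‖ = 1 (Euclidean norm). Then max_i v_i ≥ 1/((n−1)√n) and min_i v_i ≤ −1/((n−1)√n). -/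
open Matrix Filter Topology

theorem norm_toE_sq {n : ℕ} (v : Fin n → ℝ) : ‖toE v‖ ^ 2 = ∑ i, v i ^ 2 := by
  simp [EuclideanSpace.norm_sq_eq, toE]

/-- In a zero-sum vector bounded above by `M`, every coordinate is at least `-(n - 1) M`. -/
theorem neg_mul_le_of_sum_eq_zero {n : ℕ} {v : Fin n → ℝ} (hsum : ∑ i, v i = 0) {M : ℝ}
    (hM : ∀ i, v i ≤ M) (i : Fin n) : -((n - 1 : ℝ) * M) ≤ v i := by
  have hnonneg : M - v i ≤ ∑ j, (M - v j) :=
    Finset.single_le_sum (f := fun j => M - v j) (fun j _ => sub_nonneg.2 (hM j))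
      (Finset.mem_univ i)
  simp only [Finset.sum_sub_distrib, hsum, Finset.sum_const, Finset.card_univ, Fintype.card_fin,
    nsmul_eq_mul] at hnonneg
  linarith

/-- An upper bound for the coordinates of a zero-sum unit vector is at least
`1 / ((n - 1) √n)`. -/
theorem one_div_le_of_forall_le {n : ℕ} (hn : 2 ≤ n) {v : Fin n → ℝ} (hsum : ∑ i, v i = 0)
    (hsq : ∑ i, v i ^ 2 = 1) {M : ℝ} (hM : ∀ i, v i ≤ M) :
    1 / ((n - 1 : ℝ) * Real.sqrt n) ≤ M := by
  have hn' : (2 : ℝ) ≤ n := by exact_mod_cast hn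
  have hM0 : 0 ≤ M := by
    have h := Finset.sum_le_sum fun i (_ : i ∈ Finset.univ) => hM i
    simp only [hsum, Finset.sum_const, Finset.card_univ, Fintype.card_fin, nsmul_eq_mul] at h
    exact nonneg_of_mul_nonneg_right h (by linarith)
  have hle : ∀ i, v i ^ 2 ≤ ((n - 1 : ℝ) * M) ^ 2 := fun i =>
    sq_le_sq' (neg_mul_le_of_sum_eq_zero hsum hM i) ((hM i).trans (by nlinarith))
  have hbound : 1 ≤ (n : ℝ) * ((n - 1 : ℝ) * M) ^ 2 := by
    have h := Finset.sum_le_sum fun i (_ : i ∈ Finset.univ) => hle i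
    simpa only [hsq, Finset.sum_const, Finset.card_univ, Fintype.card_fin, nsmul_eq_mul] using h
  have hpos : 0 < (n - 1 : ℝ) * Real.sqrt n :=
    mul_pos (by linarith) (Real.sqrt_pos.2 (by linarith))
  rw [div_le_iff₀ hpos]
  refine (sq_le_sq₀ zero_le_one (mul_nonneg hM0 hpos.le)).1 ?_
  calc (1 : ℝ) ^ 2 ≤ (n : ℝ) * ((n - 1 : ℝ) * M) ^ 2 := by simpa using hbound
    _ = (M * ((n - 1 : ℝ) * Real.sqrt n)) ^ 2 := by
      rw [mul_pow, mul_pow, mul_pow, Real.sq_sqrt (Nat.cast_nonneg n)]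
      ring

/-- If `n ≥ 2`, `∑ᵢ vᵢ = 0` and `‖v‖ = 1` (Euclidean), then
`maxᵢ vᵢ ≥ 1/((n−1)√n)` and `minᵢ vᵢ ≤ −1/((n−1)√n)`. -/
theorem stmt14 {n : ℕ} (hn : 2 ≤ n) (v : Fin n → ℝ) (hsum : ∑ i, v i = 0)
    (hnorm : ‖toE v‖ = 1) :
    1 / ((n - 1 : ℝ) * Real.sqrt n) ≤ ⨆ i, v i ∧
    (⨅ i, v i) ≤ -(1 / ((n - 1 : ℝ) * Real.sqrt n)) := by
  have hsq : ∑ i, v i ^ 2 = 1 := by rw [← norm_toE_sq, hnorm, one_pow]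
  refine ⟨one_div_le_of_forall_le hn hsum hsq (le_ciSup (Set.finite_range v).bddAbove),
    le_neg_of_le_neg ?_⟩
  refine one_div_le_of_forall_le (v := -v) hn (by simp [hsum]) (by simpa using hsq) fun i => ?_
  exact neg_le_neg (ciInf_le (Set.finite_range v).bddBelow i)
end

section
/- Let n ≥ 2 and set C := (n−1)√n + 2n(n−1)². Then for every ε > 0 and all vectors v, w ∈ ℝⁿ with Σᵢ vᵢ = Σᵢ wᵢ = 0, ‖v‖ = ‖w‖ = 1 and ‖v − w‖ ≤ ε, there exist an n×n row-stochastic matrix S = (s_{ij}) with max_{i,j} |s_{ij} − δ_{ij}| ≤ C√ε and a real number t > 0 such that S v = t w. -/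
open Matrix Filter Topology

/-- If a vector with coordinate sum zero in dimension `n` has a coordinate at least `1 / √n`, then
some coordinate is at most `-1 / ((n - 1) √n)`. -/
theorem exists_le_neg_of_sum_eq_zero {n : ℕ} (hn : 2 ≤ n) (v : Fin n → ℝ) (hv : ∑ i, v i = 0)
    (i : Fin n) (hi : 1 ≤ v i * √n) :
    ∃ q, v q * ((n - 1 : ℝ) * √n) ≤ -1 := by
  by_contra! h
  have h2 : (2 : ℝ) ≤ n := by exact_mod_cast hn
  have hne : (Finset.univ.erase i).Nonempty := by
    rw [← Finset.card_pos, Finset.card_erase_of_mem (Finset.mem_univ i), Finset.card_univ,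
      Fintype.card_fin]
    omega
  have hs := Finset.sum_lt_sum_of_nonempty hne (fun j _ => h j)
  have he := Finset.add_sum_erase Finset.univ v (Finset.mem_univ i)
  rw [← Finset.sum_mul, Finset.sum_const, Finset.card_erase_of_mem (Finset.mem_univ i),
    Finset.card_univ, Fintype.card_fin, nsmul_eq_mul, Nat.cast_pred (by omega)] at hs
  have he' : ∑ x ∈ Finset.univ.erase i, v x = -v i := by linarith
  rw [he'] at hs
  nlinarith

/-- A unit vector with coordinate sum zero in dimension `n` has a coordinate at least
`1 / ((n - 1) √n)` and a coordinate at most `-1 / ((n - 1) √n)`. -/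
theorem exists_le_neg_and_le {n : ℕ} (hn : 2 ≤ n) (v : Fin n → ℝ) (hv : ∑ i, v i = 0)
    (hvn : ∑ i, v i ^ 2 = 1) :
    ∃ p q, 1 ≤ v p * ((n - 1 : ℝ) * √n) ∧ v q * ((n - 1 : ℝ) * √n) ≤ -1 := by
  have h2 : (2 : ℝ) ≤ n := by exact_mod_cast hn
  have hsq : √(n : ℝ) ^ 2 = n := Real.sq_sqrt (by positivity)
  obtain ⟨i, hi⟩ : ∃ i, 1 ≤ v i ^ 2 * n := by
    by_contra! h
    have hs := Finset.sum_lt_sum_of_nonempty (s := Finset.univ) ⟨⟨0, by omega⟩, by simp⟩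
      (fun j _ => h j)
    rw [← Finset.sum_mul, hvn] at hs
    simp at hs
  have hi' : 1 ≤ |v i * √n| := by
    rw [← one_le_sq_iff_one_le_abs, mul_pow, hsq]
    exact hi
  rcases le_abs.1 hi' with h | h
  · obtain ⟨q, hq⟩ := exists_le_neg_of_sum_eq_zero hn v hv i h
    exact ⟨i, q, by nlinarith, hq⟩
  · obtain ⟨p, hp⟩ := exists_le_neg_of_sum_eq_zero hn (fun j => -v j) (by simp [hv]) i
      (by linarith)
    exact ⟨p, i, by linarith, by nlinarith⟩

/-- Moving from `x` towards a value `q ≤ -1/R` by a fraction of order `ε` suffices to reach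
`t * y`, when `y` is `ε`-close to `x` and `t * y ≤ x`. -/
theorem exists_shift_of_le {R ε t x y q : ℝ} (hR : 1 ≤ R) (hε : 0 < ε) (ht : 0 < t)
    (htε : t = 1 - 2 * R * ε) (hx : |x| ≤ 1) (hxy : |x - y| ≤ ε) (hq : q * R ≤ -1)
    (hle : t * y ≤ x) :
    ∃ a, 0 ≤ a ∧ a ≤ (R + 2 * R ^ 2) * ε ∧ (1 - a) * x + a * q = t * y := by
  have hxy' := (abs_le.1 hxy).2
  have hx' := (abs_le.1 hx).2
  have hd : x - t * y ≤ t * ε + 2 * R * ε * x := by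
    have := mul_le_mul_of_nonneg_left hxy' ht.le
    subst htε
    linarith
  have hRε : 0 < R * ε := by positivity
  have htε' : t * ε ≤ ε := by nlinarith
  have key : 0 < x - q ∧ x - t * y ≤ (R + 2 * R ^ 2) * ε * (x - q) := by
    rcases le_or_gt 0 x with h0 | h0
    · have h1 : 1 ≤ (x - q) * R := by nlinarith
      refine ⟨by nlinarith, ?_⟩
      have h3 : x - t * y ≤ (1 + 2 * R) * ε := by nlinarith
      have h4 : 0 ≤ (1 + 2 * R) * ε := by positivity
      nlinarith [mul_le_mul_of_nonneg_left h1 h4]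
    · have h5 : 0 ≤ ε * (t + 2 * R * x) := by linarith
      have h6 : 0 ≤ t + 2 * R * x := nonneg_of_mul_nonneg_right h5 hε
      have h1 : 1 / 2 ≤ (x - q) * R := by nlinarith
      refine ⟨by nlinarith, ?_⟩
      have h3 : x - t * y ≤ ε := by nlinarith
      have h4 : 0 ≤ (1 + 2 * R) * ε := by positivity
      nlinarith [mul_le_mul_of_nonneg_left h1 h4]
  obtain ⟨hpos, hle'⟩ := key
  refine ⟨(x - t * y) / (x - q), div_nonneg (by linarith) hpos.le, (div_le_iff₀ hpos).2 hle', ?_⟩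
  field_simp
  ring

/-- The row that puts mass `1 - a` on `i` and mass `a` on `k`. -/
theorem exists_two_point_row {n : ℕ} (v : Fin n → ℝ) (i k : Fin n) {a : ℝ} (h0 : 0 ≤ a)
    (h1 : a ≤ 1) :
    ∃ r : Fin n → ℝ, (∀ j, 0 ≤ r j ∧ r j ≤ 1) ∧ ∑ j, r j = 1 ∧
      (∀ j, |r j - if i = j then 1 else 0| ≤ a) ∧
      ∑ j, r j * v j = (1 - a) * v i + a * v k := by
  refine ⟨fun j => (1 - a) * (if i = j then 1 else 0) + a * (if k = j then 1 else 0),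
    fun j => ?_, ?_, fun j => ?_, ?_⟩
  · dsimp only
    split_ifs <;> constructor <;> linarith
  · simp [Finset.sum_add_distrib]
  · dsimp only
    rw [abs_le]
    split_ifs <;> constructor <;> linarith
  · simp [Finset.sum_add_distrib, add_mul]

/-- Let `n ≥ 2` and `C = (n−1)√n + 2n(n−1)²`. For all `ε > 0` and all
unit vectors `v, w` in the hyperplane `∑ᵢ vᵢ = 0` with `‖v − w‖ ≤ ε`, there exist a
stochastic matrix `S` with `max_{i,j} |s_{ij} − δ_{ij}| ≤ C√ε` and `t > 0` with `Sv = tw`. -/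
theorem stmt15 {n : ℕ} (hn : 2 ≤ n) (ε : ℝ) (hε : 0 < ε) (v w : Fin n → ℝ)
    (hv : ∑ i, v i = 0) (hw : ∑ i, w i = 0)
    (hvn : ‖toE v‖ = 1) (hwn : ‖toE w‖ = 1)
    (hclose : ‖toE (v - w)‖ ≤ ε) :
    ∃ S : Matrix (Fin n) (Fin n) ℝ, IsStochastic S ∧
      (∀ i j, |S i j - if i = j then 1 else 0| ≤
        ((n - 1 : ℝ) * Real.sqrt n + 2 * n * (n - 1) ^ 2) * Real.sqrt ε) ∧
      ∃ t : ℝ, 0 < t ∧ S.mulVec v = t • w := by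
  have h2 : (2 : ℝ) ≤ n := by exact_mod_cast hn
  have hsq : √(n : ℝ) ^ 2 = n := Real.sq_sqrt (by positivity)
  have hs1 : 1 ≤ √(n : ℝ) := Real.one_le_sqrt.2 (by linarith)
  have hv2 : ∑ i, v i ^ 2 = 1 := by
    have h := EuclideanSpace.norm_sq_eq (toE v)
    rw [hvn] at h
    simpa [toE] using h.symm
  have hv1 : ∀ i, |v i| ≤ 1 := fun i =>
    (by simpa [toE] using PiLp.norm_apply_le (toE v) i : |v i| ≤ ‖toE v‖).trans_eq hvn
  have hw1 : ∀ i, |w i| ≤ 1 := fun i =>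
    (by simpa [toE] using PiLp.norm_apply_le (toE w) i : |w i| ≤ ‖toE w‖).trans_eq hwn
  have hvw : ∀ i, |v i - w i| ≤ ε := fun i =>
    (by simpa [toE] using PiLp.norm_apply_le (toE (v - w)) i : |v i - w i| ≤ _).trans hclose
  obtain ⟨p, q, hp, hq⟩ := exists_le_neg_and_le hn v hv hv2
  have hC : (n - 1 : ℝ) * √n + 2 * n * (n - 1) ^ 2 =
      (n - 1 : ℝ) * √n + 2 * ((n - 1 : ℝ) * √n) ^ 2 := by
    rw [mul_pow, hsq]; ring
  rw [hC]
  have hR : 1 ≤ (n - 1 : ℝ) * √n := by nlinarith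
  generalize (n - 1 : ℝ) * √n = R at hR hp hq
  suffices h : ∃ t : ℝ, 0 < t ∧ ∀ i, ∃ r : Fin n → ℝ, (∀ j, 0 ≤ r j ∧ r j ≤ 1) ∧ ∑ j, r j = 1 ∧
      (∀ j, |r j - if i = j then 1 else 0| ≤ (R + 2 * R ^ 2) * √ε) ∧
      ∑ j, r j * v j = t * w i by
    obtain ⟨t, ht, h⟩ := h
    choose S hS01 hS1 hSδ hSv using h
    exact ⟨S, ⟨hS01, hS1⟩, hSδ, t, ht, funext hSv⟩
  rcases le_or_gt 1 ((R + 2 * R ^ 2) * √ε) with hbig | hsmall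
  · have hRpos : 0 < R := by linarith
    refine ⟨1 / R, by positivity, fun i => ?_⟩
    have hpR : 1 / R ≤ v p := (div_le_iff₀ hRpos).2 hp
    have hqR : v q ≤ -(1 / R) := by
      rw [← neg_div]; exact (le_div_iff₀ hRpos).2 hq
    have hinv : 0 < 1 / R := by positivity
    have hd : 0 < v p - v q := by linarith
    obtain ⟨hw', hw''⟩ := abs_le.1 (hw1 i)
    obtain ⟨r, hr01, hr1, -, hrv⟩ := exists_two_point_row v q p
      (a := (1 / R * w i - v q) / (v p - v q)) (div_nonneg (by nlinarith) hd.le)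
      ((div_le_one hd).2 (by nlinarith))
    refine ⟨r, hr01, hr1, fun j => le_trans ?_ hbig, ?_⟩
    · obtain ⟨h0, h1⟩ := hr01 j
      rw [abs_le]
      split_ifs <;> constructor <;> linarith
    · rw [hrv]
      generalize 1 / R * w i = z
      field_simp
      ring
  · have hs0 : 0 < √ε := Real.sqrt_pos.2 hε
    have hss : √ε * √ε = ε := Real.mul_self_sqrt hε.le
    have hlt : √ε < 1 := by nlinarith
    have hεs : ε ≤ √ε := by nlinarith
    have hCε : (R + 2 * R ^ 2) * ε ≤ (R + 2 * R ^ 2) * √ε := by gcongr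
    have ht : 0 < 1 - 2 * R * ε := by nlinarith [mul_pos (by linarith : 0 < R) hε]
    refine ⟨1 - 2 * R * ε, ht, fun i => ?_⟩
    obtain ⟨k, a, ha0, ha, hav⟩ : ∃ k a, 0 ≤ a ∧ a ≤ (R + 2 * R ^ 2) * ε ∧
        (1 - a) * v i + a * v k = (1 - 2 * R * ε) * w i := by
      rcases le_total ((1 - 2 * R * ε) * w i) (v i) with h | h
      · exact ⟨q, exists_shift_of_le hR hε ht rfl (hv1 i) (hvw i) hq h⟩
      · obtain ⟨a, ha0, ha, hav⟩ := exists_shift_of_le (x := -v i) (y := -w i) (q := -v p) hR hε ht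
          rfl (by simpa using hv1 i)
          (by rw [neg_sub_neg, abs_sub_comm]; exact hvw i) (by linarith) (by linarith)
        exact ⟨p, a, ha0, ha, by linarith⟩
    obtain ⟨r, hr01, hr1, hrδ, hrv⟩ := exists_two_point_row v i k ha0 (by linarith)
    exact ⟨r, hr01, hr1, fun j => (hrδ j).trans (ha.trans hCε), hrv.trans hav⟩
end

section
/- Let n ≥ 2 and set C := (n−1)√n + 2n(n−1)². For every ε > 0, every n×n row-stochastic matrix S, and all nonzero vectors x, y ∈ ℝⁿ with Σᵢ xᵢ = Σᵢ yᵢ = 0 whose (unoriented) angle satisfies ∠(x, y) ≤ ε²/C², there exist a row-stochastic matrix R = (r_{ij}) and a real number λ > 0 such that S x = λ R y and max_{i,j} |s_{ij} − r_{ij}| ≤ ε. Moreover, if in addition ε < 1/2 and S is invertible, then R can be chosen invertible. -/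
open Matrix Filter Topology

theorem IsStochastic.mul {n : ℕ} {S T : Matrix (Fin n) (Fin n) ℝ}
    (hS : IsStochastic S) (hT : IsStochastic T) : IsStochastic (S * T) := by
  have hnonneg : ∀ i j, 0 ≤ (S * T) i j := fun i j => by
    rw [Matrix.mul_apply]
    exact Finset.sum_nonneg fun k _ => mul_nonneg (hS.1 i k).1 (hT.1 k j).1
  have hsum : ∀ i, ∑ j, (S * T) i j = 1 := fun i => by
    simp only [Matrix.mul_apply]
    rw [Finset.sum_comm]
    simp [← Finset.mul_sum, hT.2, hS.2]
  refine ⟨fun i j => ⟨hnonneg i j, ?_⟩, hsum⟩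
  rw [← hsum i]
  exact Finset.single_le_sum (fun k _ => hnonneg i k) (Finset.mem_univ j)

/-- A unit vector orthogonal to the constants has an entry bounded below. -/
theorem exists_le_entry_of_sum_eq_zero {n : ℕ} (hn : 2 ≤ n) {y : Fin n → ℝ}
    (hy : ∑ i, y i = 0) (hy1 : ∑ i, y i ^ 2 = 1) :
    ∃ a, 1 / ((n - 1 : ℝ) * Real.sqrt n) ≤ y a := by
  by_contra! h
  have hn' : (2 : ℝ) ≤ n := by exact_mod_cast hn
  have hs : 0 < Real.sqrt n := Real.sqrt_pos.2 (by linarith)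
  set m : ℝ := 1 / ((n - 1 : ℝ) * Real.sqrt n) with hm
  have hm0 : 0 < m := by
    have : (0 : ℝ) < n - 1 := by linarith
    positivity
  have hnm : (n - 1 : ℝ) * m = 1 / Real.sqrt n := by
    have : (n - 1 : ℝ) ≠ 0 := by linarith
    rw [hm]
    field_simp
  have hsq : ∀ i, y i ^ 2 < 1 / n := fun i => by
    have hlow : -((n - 1 : ℝ) * m) < y i := by
      have h1 := Finset.add_sum_erase Finset.univ y (Finset.mem_univ i)
      have h2 : ∑ j ∈ Finset.univ.erase i, y j < ∑ _j ∈ Finset.univ.erase i, m := by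
        apply Finset.sum_lt_sum_of_nonempty
        · rw [← Finset.card_pos, Finset.card_erase_of_mem (Finset.mem_univ i)]
          simp
          omega
        · exact fun j _ => h j
      rw [Finset.sum_const, Finset.card_erase_of_mem (Finset.mem_univ i), nsmul_eq_mul,
        Finset.card_univ, Fintype.card_fin, Nat.cast_sub (by omega), Nat.cast_one] at h2
      linarith
    have hup : y i < (n - 1 : ℝ) * m := by nlinarith [h i]
    rw [hnm] at hlow hup
    calc y i ^ 2 < (1 / Real.sqrt n) ^ 2 := sq_lt_sq' hlow hup
      _ = 1 / n := by rw [div_pow, Real.sq_sqrt (by linarith), one_pow]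
  have : ∑ i, y i ^ 2 < ∑ _i : Fin n, (1 : ℝ) / n :=
    Finset.sum_lt_sum_of_nonempty ⟨⟨0, by omega⟩, Finset.mem_univ _⟩ fun i _ => hsq i
  rw [hy1, Finset.sum_const, Finset.card_univ, Fintype.card_fin, nsmul_eq_mul,
    mul_one_div_cancel (by linarith)] at this
  exact lt_irrefl _ this

theorem norm_sub_le_angle {V : Type*} [NormedAddCommGroup V] [InnerProductSpace ℝ V] {x y : V}
    (hx : ‖x‖ = 1) (hy : ‖y‖ = 1) : ‖x - y‖ ≤ InnerProductGeometry.angle x y := by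
  refine le_of_sq_le_sq ?_ (InnerProductGeometry.angle_nonneg x y)
  have h := Real.one_sub_sq_div_two_le_cos (x := InnerProductGeometry.angle x y)
  have h' := InnerProductGeometry.cos_angle_mul_norm_mul_norm x y
  rw [hx, hy] at h'
  rw [norm_sub_sq_real, hx, hy]
  linarith

/-- If `x` is uniformly close to `y`, a stochastic matrix near the identity sends `y` to a
positive multiple of `x`. -/
theorem exists_stochastic_mulVec_eq {n : ℕ} {x y : Fin n → ℝ} {m δ : ℝ} (hm : 0 < m) (hδ : 0 ≤ δ)
    {a b : Fin n} (ha : m ≤ y a) (hb : y b ≤ -m) (hxy : ∀ i, |x i - y i| ≤ δ) :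
    ∃ B : Matrix (Fin n) (Fin n) ℝ, ∃ t : ℝ, t = δ / (δ + m) ∧ IsStochastic B ∧
      B *ᵥ y = (1 - t) • x ∧
      (∀ S : Matrix (Fin n) (Fin n) ℝ, IsStochastic S → ∀ i j, |S i j - (S * B) i j| ≤ t) ∧
      (δ < m → IsUnit B) := by
  obtain ⟨t, ht⟩ : ∃ t : ℝ, t = δ / (δ + m) := ⟨_, rfl⟩
  have hδm : 0 < δ + m := by linarith
  have ht0 : 0 ≤ t := ht ▸ div_nonneg hδ hδm.le
  have ht1 : t < 1 := ht ▸ (div_lt_one hδm).2 (by linarith)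
  have htm : (1 - t) * δ = t * m := by
    rw [ht]
    field_simp
    ring
  set D : ℝ := y a - y b with hD
  have hD0 : 0 < D := by linarith
  set p : Fin n → ℝ := fun i => ((1 - t) * (x i - y i) - t * y b) / D with hp
  set q : Fin n → ℝ := fun i => (t * y a - (1 - t) * (x i - y i)) / D with hq
  have hdi : ∀ i, -(t * m) ≤ (1 - t) * (x i - y i) ∧ (1 - t) * (x i - y i) ≤ t * m := fun i => by
    have h := abs_le.1 (hxy i)
    rw [← htm]
    constructor <;> nlinarith
  have hp0 : ∀ i, 0 ≤ p i := fun i => div_nonneg (by nlinarith [(hdi i).1]) hD0.le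
  have hq0 : ∀ i, 0 ≤ q i := fun i => div_nonneg (by nlinarith [(hdi i).2]) hD0.le
  have hpq : ∀ i, p i + q i = t := fun i => by
    simp only [hp, hq]
    rw [← add_div, div_eq_iff hD0.ne', hD]
    ring
  have hpqy : ∀ i, p i * y a + q i * y b = (1 - t) * (x i - y i) := fun i => by
    simp only [hp, hq]
    rw [div_mul_eq_mul_div, div_mul_eq_mul_div, ← add_div, div_eq_iff hD0.ne', hD]
    ring
  set T : Matrix (Fin n) (Fin n) ℝ :=
    Matrix.of fun i j => (if j = a then p i else 0) + (if j = b then q i else 0) with hT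
  have hT0 : ∀ i j, 0 ≤ T i j ∧ T i j ≤ t := fun i j => by
    have h1 := hp0 i
    have h2 := hq0 i
    have h3 := hpq i
    simp only [hT, Matrix.of_apply]
    constructor <;> split_ifs <;> linarith
  have hTv : ∀ z i, (T *ᵥ z) i = p i * z a + q i * z b := fun z i => by
    simp [hT, Matrix.mulVec, dotProduct, add_mul, Finset.sum_add_distrib]
  have hBv : ∀ z i, (((1 - t) • 1 + T) *ᵥ z) i = (1 - t) * z i + (p i * z a + q i * z b) :=
    fun z i => by
      rw [Matrix.add_mulVec, Pi.add_apply, hTv, Matrix.smul_mulVec, Matrix.one_mulVec]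
      rfl
  refine ⟨(1 - t) • 1 + T, t, ht, ?_, ?_, ?_, ?_⟩
  · have hnonneg : ∀ i j, 0 ≤ ((1 - t) • (1 : Matrix (Fin n) (Fin n) ℝ) + T) i j := fun i j => by
      have := (hT0 i j).1
      simp only [Matrix.add_apply, Matrix.smul_apply, Matrix.one_apply, smul_eq_mul]
      split_ifs <;> linarith
    have hsum : ∀ i, ∑ j, ((1 - t) • (1 : Matrix (Fin n) (Fin n) ℝ) + T) i j = 1 := fun i => by
      have h := hBv 1 i
      simp only [Matrix.mulVec, dotProduct, Pi.one_apply, mul_one] at h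
      rw [h, hpq]
      ring
    refine ⟨fun i j => ⟨hnonneg i j, ?_⟩, hsum⟩
    exact (Finset.single_le_sum (fun k _ => hnonneg i k) (Finset.mem_univ j)).trans_eq (hsum i)
  · ext i
    rw [hBv, hpqy, Pi.smul_apply, smul_eq_mul]
    ring
  · intro S hS i j
    have h0 : 0 ≤ (S * T) i j := by
      rw [Matrix.mul_apply]
      exact Finset.sum_nonneg fun k _ => mul_nonneg (hS.1 i k).1 (hT0 k j).1
    have h1 : (S * T) i j ≤ t := by
      rw [Matrix.mul_apply]
      calc ∑ k, S i k * T k j ≤ ∑ k, S i k * t :=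
            Finset.sum_le_sum fun k _ => mul_le_mul_of_nonneg_left (hT0 k j).2 (hS.1 i k).1
        _ = t := by rw [← Finset.sum_mul, hS.2, one_mul]
    have h2 : S i j - (S * ((1 - t) • 1 + T)) i j = t * S i j - (S * T) i j := by
      rw [mul_add, Matrix.mul_smul, mul_one, Matrix.add_apply, Matrix.smul_apply, smul_eq_mul]
      ring
    have h3 := hS.1 i j
    rw [h2, abs_le]
    constructor <;> nlinarith
  · intro hlt
    rw [← Matrix.mulVec_injective_iff_isUnit,
      ← Matrix.coe_mulVecLin, injective_iff_map_eq_zero]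
    intro z hz
    have hz' : ∀ i, (1 - t) * z i + (p i * z a + q i * z b) = 0 := fun i => by
      rw [← hBv]
      exact congrFun hz i
    have hzab : z a = z b := by
      have key : (1 - t) * (z a - z b) * (x a - x b) = 0 := by
        have h := congrArg (D * ·) ((hz' a).trans (hz' b).symm)
        simp only [hp, hq] at h
        field_simp at h
        linear_combination h + (1 - t) * (z a - z b) * hD
      have h1 := abs_le.1 (hxy a)
      have h2 := abs_le.1 (hxy b)
      have h3 : 0 < x a - x b := by linarith
      have h4 : 0 < 1 - t := by linarith
      rcases mul_eq_zero.1 key with h | h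
      · rcases mul_eq_zero.1 h with h | h <;> linarith
      · linarith
    have hz'' : ∀ i, (1 - t) * z i + t * z a = 0 := fun i => by
      rw [← hz' i, ← hzab, ← add_mul, hpq]
    have hza : z a = 0 := by linarith [hz'' a]
    ext i
    have h := hz'' i
    rw [hza, mul_zero, add_zero] at h
    exact (mul_eq_zero.1 h).resolve_left (by linarith)

/-- Let `n ≥ 2`, `C = (n−1)√n + 2n(n−1)²`. For every `ε > 0`, every
stochastic `S`, and all nonzero `x, y` in the hyperplane `∑ᵢ = 0` with
`∠(x,y) ≤ ε²/C²`, there are a stochastic `R` and `λ > 0` with `Sx = λ Ry` and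
`max_{i,j}|s_{ij} − r_{ij}| ≤ ε`; moreover, if `ε < 1/2` and `S` is invertible,
`R` can be chosen invertible. -/
theorem stmt16 {n : ℕ} (hn : 2 ≤ n) (ε : ℝ) (hε : 0 < ε)
    (S : Matrix (Fin n) (Fin n) ℝ) (hS : IsStochastic S)
    (x y : Fin n → ℝ) (hx0 : x ≠ 0) (hy0 : y ≠ 0)
    (hx : ∑ i, x i = 0) (hy : ∑ i, y i = 0)
    (hangle : InnerProductGeometry.angle (toE x) (toE y) ≤
      ε ^ 2 / ((n - 1 : ℝ) * Real.sqrt n + 2 * n * (n - 1) ^ 2) ^ 2) :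
    (∃ R : Matrix (Fin n) (Fin n) ℝ, ∃ l : ℝ, IsStochastic R ∧ 0 < l ∧
      S.mulVec x = l • R.mulVec y ∧ ∀ i j, |S i j - R i j| ≤ ε) ∧
    (ε < 1 / 2 → IsUnit S →
      ∃ R : Matrix (Fin n) (Fin n) ℝ, ∃ l : ℝ, IsStochastic R ∧ 0 < l ∧
        S.mulVec x = l • R.mulVec y ∧ (∀ i j, |S i j - R i j| ≤ ε) ∧ IsUnit R) := by
  have hn' : (2 : ℝ) ≤ n := by exact_mod_cast hn
  set K : ℝ := (n - 1 : ℝ) * Real.sqrt n with hK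
  set C : ℝ := K + 2 * n * (n - 1) ^ 2 with hC
  have hK1 : 1 ≤ K := one_le_mul_of_one_le_of_one_le (by linarith)
    (Real.one_le_sqrt.2 (by linarith))
  have hKC : K ≤ C := le_add_of_nonneg_right (by positivity)
  set δ : ℝ := ε ^ 2 / C ^ 2 with hδ
  have hδ0 : 0 ≤ δ := by positivity
  have hδε : ε ≤ 1 → δ ≤ ε * (1 / K) := fun h => by
    rw [hδ, mul_one_div, div_le_div_iff₀ (by nlinarith) (by linarith)]
    have : ε * K ≤ C ^ 2 := by nlinarith
    nlinarith
  have hX0 : toE x ≠ 0 := by simpa [toE] using hx0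
  have hY0 : toE y ≠ 0 := by simpa [toE] using hy0
  set r : ℝ := ‖toE x‖ with hr
  set s : ℝ := ‖toE y‖ with hs
  have hr0 : 0 < r := norm_pos_iff.2 hX0
  have hs0 : 0 < s := norm_pos_iff.2 hY0
  have hsq : ∑ i, (s⁻¹ * y i) ^ 2 = 1 := by
    have h : s ^ 2 = ∑ i, y i ^ 2 := by
      rw [hs, EuclideanSpace.real_norm_sq_eq]
      rfl
    simp only [mul_pow]
    rw [← Finset.mul_sum, ← h, inv_pow, inv_mul_cancel₀ (by positivity)]
  have hsum : ∑ i, s⁻¹ * y i = 0 := by rw [← Finset.mul_sum, hy, mul_zero]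
  obtain ⟨a, ha⟩ := exists_le_entry_of_sum_eq_zero hn hsum hsq
  obtain ⟨b, hb⟩ := exists_le_entry_of_sum_eq_zero hn (y := fun i => -(s⁻¹ * y i))
    (by simpa using hsum) (by simpa using hsq)
  have hclose : ∀ i, |r⁻¹ * x i - s⁻¹ * y i| ≤ δ := fun i => by
    have h := norm_sub_le_angle (x := r⁻¹ • toE x) (y := s⁻¹ • toE y)
      (norm_smul_inv_norm hX0) (norm_smul_inv_norm hY0)
    rw [InnerProductGeometry.angle_smul_left_of_pos _ _ (inv_pos.2 hr0),
      InnerProductGeometry.angle_smul_right_of_pos _ _ (inv_pos.2 hs0)] at h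
    exact ((PiLp.norm_apply_le (r⁻¹ • toE x - s⁻¹ • toE y) i).trans h).trans hangle
  obtain ⟨B, t, ht, hB, hBy, hBS, hBunit⟩ := exists_stochastic_mulVec_eq
    (x := fun i => r⁻¹ * x i) (y := fun i => s⁻¹ * y i) (m := 1 / K) (by positivity) hδ0
    ha (le_neg_of_le_neg hb) hclose
  have hden : 0 < δ + 1 / K := by positivity
  have ht1 : t < 1 := by
    rw [ht, div_lt_one hden]
    exact lt_add_of_pos_right _ (by positivity)
  have htε : t ≤ ε := by
    rcases le_total ε 1 with h | h
    · rw [ht, div_le_iff₀ hden]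
      nlinarith [hδε h, mul_nonneg hε.le hδ0]
    · linarith
  have hmul : S *ᵥ x = (r / ((1 - t) * s)) • (S * B) *ᵥ y := by
    have hx' : x = r • fun i => r⁻¹ * x i := by
      ext i
      simp [hr0.ne']
    have hy' : y = s • fun i => s⁻¹ * y i := by
      ext i
      simp [hs0.ne']
    have h1t : 1 - t ≠ 0 := by linarith
    rw [← Matrix.mulVec_mulVec]
    conv_rhs => rw [hy', Matrix.mulVec_smul, hBy]
    conv_lhs => rw [hx']
    simp only [Matrix.mulVec_smul, smul_smul]
    congr 1
    field_simp
  have hl : 0 < r / ((1 - t) * s) := div_pos hr0 (mul_pos (by linarith) hs0)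
  have hdist : ∀ i j, |S i j - (S * B) i j| ≤ ε := fun i j => (hBS S hS i j).trans htε
  refine ⟨⟨S * B, _, hS.mul hB, hl, hmul, hdist⟩, fun hε2 hSu =>
    ⟨S * B, _, hS.mul hB, hl, hmul, hdist, hSu.mul (hBunit ?_)⟩⟩
  have : 0 < 1 / K := by positivity
  nlinarith [hδε (by linarith)]
end
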